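/- arXiv:2405.20056 — 3 statements merged into one kernel-verified Lean document; each statement's English description precedes it below -/
import Mathlib

section
/- Let r ≥ 2 and h ≥ 1 be integers and let κ, δ, n be positive integers with δ ≤ κ and n ≥ κ + r(h+1). Let G be a connected simple graph on n vertices with minimum degree δ and h-extra r-component connectivity κ^h_r(G) = κ. Then ρ(G) ≤ ρ(G*), where G* is the graph obtained from (K_κ ∨ (K_{n−κ−(r−1)(h+1)} ∪ (r−2)K_{h+1} ∪ K_h)) ∪ K_1 by adding δ−1 edges between the vertex of K_1 and δ−1 vertices of K_κ and then adding one edge between the vertex of K_1 and a vertex of K_h. Equality holds if and only if G is isomorphic to G*. -/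
open SimpleGraph

section Core

variable {V : Type*}

lemma adjMatrix_isHermitian [Fintype V] [DecidableEq V]
    (G : SimpleGraph V) [DecidableRel G.Adj] :
    (G.adjMatrix ℝ).IsHermitian := by
  ext i j
  simp [Matrix.conjTranspose_apply, SimpleGraph.adj_comm]

/-- The spectral radius (largest adjacency eigenvalue) of a finite simple graph. -/
noncomputable def SimpleGraph.spectralRadius [Finite V] (G : SimpleGraph V) : ℝ :=
  letI := Fintype.ofFinite V
  letI := Classical.decEq V
  letI := Classical.decRel G.Adj
  ⨆ i, (adjMatrix_isHermitian G).eigenvalues i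

/-- `x` is the Perron vector of a connected graph `G`: a positive unit eigenvector
of the adjacency matrix for the eigenvalue `G.spectralRadius`. -/
def SimpleGraph.IsPerronVector [Fintype V] [DecidableEq V] (G : SimpleGraph V)
    [DecidableRel G.Adj] (x : V → ℝ) : Prop :=
  (∀ v, 0 < x v) ∧ (∑ v, x v ^ 2 = 1) ∧
    (G.adjMatrix ℝ).mulVec x = G.spectralRadius • x

/-- `S` is a vertex cut witnessing the `h`-extra `r`-component condition: removing `S`
leaves at least `r` connected components, each with at least `h+1` vertices. -/
def GoodVertexCut (G : SimpleGraph V) (r h : ℕ) (S : Finset V) : Prop :=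
  r ≤ Nat.card (G.induce ((S : Set V)ᶜ)).ConnectedComponent ∧
    ∀ c : (G.induce ((S : Set V)ᶜ)).ConnectedComponent, h + 1 ≤ Nat.card c.supp

/-- `G` has `h`-extra `r`-component connectivity `κ`. -/
def HasExtraConnectivity (G : SimpleGraph V) (r h κ : ℕ) : Prop :=
  (∃ S : Finset V, S.card = κ ∧ GoodVertexCut G r h S) ∧
    ∀ S : Finset V, GoodVertexCut G r h S → κ ≤ S.card

/-- `F` is an edge cut witnessing the `h`-extra `r`-component condition: removing `F`
leaves at least `r` connected components, each with at least `h+1` vertices. -/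
def GoodEdgeCut (G : SimpleGraph V) (r h : ℕ) (F : Finset (Sym2 V)) : Prop :=
  (F : Set (Sym2 V)) ⊆ G.edgeSet ∧
    r ≤ Nat.card (G.deleteEdges (F : Set (Sym2 V))).ConnectedComponent ∧
    ∀ c : (G.deleteEdges (F : Set (Sym2 V))).ConnectedComponent, h + 1 ≤ Nat.card c.supp

/-- `G` has `h`-extra `r`-component edge-connectivity `lam`. -/
def HasExtraEdgeConnectivity (G : SimpleGraph V) (r h lam : ℕ) : Prop :=
  (∃ F : Finset (Sym2 V), F.card = lam ∧ GoodEdgeCut G r h F) ∧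
    ∀ F : Finset (Sym2 V), GoodEdgeCut G r h F → lam ≤ F.card

end Core

/-- Vertex type used for the extremal graphs of Theorem 1.2 (cases `δ ≤ κ` and
`κ < δ < κ + h`): the parts are `K_κ`, `K_{n-κ-(r-1)(h+1)}`, the `r-2` copies of
`K_{h+1}`, `K_h`, and `K_1`. -/
abbrev GVert (n r h κ : ℕ) : Type :=
  Fin κ ⊕ (Fin (n - κ - (r - 1) * (h + 1)) ⊕ ((Fin (r - 2) × Fin (h + 1)) ⊕ (Fin h ⊕ Unit)))

/-- The extremal graph `G^{κ,δ}_n` for `δ ≤ κ`: it is obtained from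
`(K_κ ∨ (K_{n-κ-(r-1)(h+1)} ∪ (r-2)K_{h+1} ∪ K_h)) ∪ K_1` by adding `δ - 1` edges between
the vertex of `K_1` and `δ - 1` vertices of `K_κ`, and one edge between the vertex of
`K_1` and a vertex of `K_h`. -/
def GStarLow (n r h κ δ : ℕ) : SimpleGraph (GVert n r h κ) :=
  SimpleGraph.fromRel fun a b =>
    match a, b with
    | .inl _, .inl _ => True
    | .inl _, .inr (.inl _) => True
    | .inl _, .inr (.inr (.inl _)) => True
    | .inl _, .inr (.inr (.inr (.inl _))) => True
    | .inl i, .inr (.inr (.inr (.inr _))) => (i : ℕ) < δ - 1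
    | .inr (.inl _), .inr (.inl _) => True
    | .inr (.inr (.inl p)), .inr (.inr (.inl q)) => p.1 = q.1
    | .inr (.inr (.inr (.inl _))), .inr (.inr (.inr (.inl _))) => True
    | .inr (.inr (.inr (.inl k))), .inr (.inr (.inr (.inr _))) => (k : ℕ) = 0
    | _, _ => False

section Spectral

open Classical Matrix

variable {V W : Type*} [Fintype V] [Fintype W]

/-- The value at `u` of the adjacency operator of `G` applied to `x`. -/
noncomputable def nbrSum (G : SimpleGraph V) (x : V → ℝ) (u : V) : ℝ :=
  ∑ v, if G.Adj u v then x v else 0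

/-- The quadratic form of the adjacency matrix of `G`. -/
noncomputable def adjForm (G : SimpleGraph V) (x : V → ℝ) : ℝ :=
  ∑ u, x u * nbrSum G x u

lemma adjMatrix_mulVec_eq_nbrSum (G : SimpleGraph V) (x : V → ℝ) :
    G.adjMatrix ℝ *ᵥ x = nbrSum G x := by
  ext u
  simp [Matrix.mulVec, dotProduct, nbrSum, SimpleGraph.adjMatrix_apply]

lemma spectralRadius_eq_iSup (G : SimpleGraph V) :
    G.spectralRadius = ⨆ i, (adjMatrix_isHermitian G).eigenvalues i := by
  have h : Fintype.ofFinite V = ‹Fintype V› := Subsingleton.elim _ _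
  unfold SimpleGraph.spectralRadius
  rw [h]

lemma posSemidef_spectralRadius_sub (G : SimpleGraph V) :
    (G.spectralRadius • (1 : Matrix V V ℝ) - G.adjMatrix ℝ).PosSemidef := by
  have hA := adjMatrix_isHermitian G
  have hD : (diagonal fun i => G.spectralRadius - hA.eigenvalues i).PosSemidef := by
    refine PosSemidef.diagonal fun i => ?_
    simp only [Pi.zero_apply, sub_nonneg, spectralRadius_eq_iSup]
    exact le_ciSup (Set.finite_range hA.eigenvalues).bddAbove i
  have key := hD.mul_mul_conjTranspose_same (hA.eigenvectorUnitary : Matrix V V ℝ)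
  convert key using 1
  have h1 := hA.spectral_theorem
  rw [Unitary.conjStarAlgAut_apply] at h1
  have h2 : (diagonal fun i => G.spectralRadius - hA.eigenvalues i) =
      G.spectralRadius • (1 : Matrix V V ℝ) - diagonal (RCLike.ofReal ∘ hA.eigenvalues) := by
    ext i j
    by_cases hij : i = j <;> simp [hij, diagonal]
  have h3 : (hA.eigenvectorUnitary : Matrix V V ℝ) *
      (hA.eigenvectorUnitary : Matrix V V ℝ)ᴴ = 1 := by
    simpa [star_eq_conjTranspose] using Unitary.coe_mul_star_self hA.eigenvectorUnitary
  rw [h2, mul_sub, sub_mul, Matrix.mul_smul, Matrix.smul_mul, mul_one, h3]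
  congr 1

lemma dotProduct_spectralRadius_sub (G : SimpleGraph V) (x : V → ℝ) :
    star x ⬝ᵥ ((G.spectralRadius • (1 : Matrix V V ℝ) - G.adjMatrix ℝ) *ᵥ x) =
      G.spectralRadius * ∑ v, x v ^ 2 - adjForm G x := by
  rw [sub_mulVec, dotProduct_sub, adjMatrix_mulVec_eq_nbrSum, smul_mulVec, one_mulVec]
  simp only [dotProduct, adjForm, star_trivial, Pi.smul_apply, smul_eq_mul, Finset.mul_sum]
  congr 1
  exact Finset.sum_congr rfl fun i _ => by ring

lemma adjForm_le (G : SimpleGraph V) (x : V → ℝ) :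
    adjForm G x ≤ G.spectralRadius * ∑ v, x v ^ 2 := by
  have h := (posSemidef_spectralRadius_sub G).dotProduct_mulVec_nonneg x
  rw [dotProduct_spectralRadius_sub] at h
  linarith

lemma nbrSum_eq_of_adjForm_eq (G : SimpleGraph V) (x : V → ℝ)
    (h : adjForm G x = G.spectralRadius * ∑ v, x v ^ 2) (u : V) :
    nbrSum G x u = G.spectralRadius * x u := by
  have h1 := ((posSemidef_spectralRadius_sub G).dotProduct_mulVec_zero_iff x).1
    (by rw [dotProduct_spectralRadius_sub, h, sub_self])
  rw [sub_mulVec, adjMatrix_mulVec_eq_nbrSum, smul_mulVec, one_mulVec, sub_eq_zero] at h1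
  simpa using (congrFun h1 u).symm

lemma adjForm_eq_of_nbrSum_eq {G : SimpleGraph V} {x : V → ℝ} {a : ℝ}
    (h : ∀ u, nbrSum G x u = a * x u) : adjForm G x = a * ∑ v, x v ^ 2 := by
  simp only [adjForm, h, Finset.mul_sum]
  exact Finset.sum_congr rfl fun i _ => by ring

lemma exists_eigenvector [Nonempty V] (G : SimpleGraph V) :
    ∃ x : V → ℝ, x ≠ 0 ∧ ∀ u, nbrSum G x u = G.spectralRadius * x u := by
  have hA := adjMatrix_isHermitian G
  obtain ⟨i, hi⟩ := exists_eq_ciSup_of_finite (f := hA.eigenvalues)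
  rw [← spectralRadius_eq_iSup] at hi
  refine ⟨hA.eigenvectorBasis i, fun h => ?_, fun u => ?_⟩
  · refine hA.eigenvectorBasis.toBasis.ne_zero i ?_
    ext v
    simpa using congrFun h v
  · rw [← adjMatrix_mulVec_eq_nbrSum, hA.mulVec_eigenvectorBasis, hi]
    simp

lemma adjForm_le_adjForm_abs (G : SimpleGraph V) (x : V → ℝ) :
    adjForm G x ≤ adjForm G fun v => |x v| := by
  simp only [adjForm, nbrSum, Finset.mul_sum]
  refine Finset.sum_le_sum fun u _ => Finset.sum_le_sum fun v _ => ?_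
  split_ifs
  · rw [← abs_mul]
    exact le_abs_self _
  · simp

/-- A connected graph has a positive eigenvector for its spectral radius. -/
lemma exists_pos_eigenvector {G : SimpleGraph V} (hG : G.Connected) :
    ∃ x : V → ℝ, (∀ v, 0 < x v) ∧ ∀ u, nbrSum G x u = G.spectralRadius * x u := by
  have := hG.nonempty
  obtain ⟨y, hy0, hy⟩ := exists_eigenvector G
  set x : V → ℝ := fun v => |y v| with hx
  have hx0 : ∀ v, 0 ≤ x v := fun v => abs_nonneg _
  have hxe : ∀ u, nbrSum G x u = G.spectralRadius * x u := by
    refine nbrSum_eq_of_adjForm_eq G x (le_antisymm (adjForm_le G x) ?_)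
    have h := adjForm_le_adjForm_abs G y
    rw [adjForm_eq_of_nbrSum_eq hy] at h
    simpa [hx] using h
  have hstep : ∀ u v, G.Adj u v → x u = 0 → x v = 0 := by
    intro u v huv hu
    have h := hxe u
    rw [hu, mul_zero, nbrSum, Finset.sum_eq_zero_iff_of_nonneg] at h
    · simpa [huv] using h v (Finset.mem_univ v)
    · intro i _
      split_ifs
      exacts [hx0 i, le_rfl]
  refine ⟨x, fun v => (hx0 v).lt_of_ne fun hv => hy0 ?_, hxe⟩
  ext u
  have hwalk : ∀ {a b : V}, G.Walk a b → x a = 0 → x b = 0 := by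
    intro a b p
    induction p with
    | nil => exact id
    | cons h _ ih => exact fun ha => ih (hstep _ _ h ha)
  obtain ⟨p⟩ := hG.preconnected v u
  simpa [hx] using hwalk p hv.symm

lemma sum_sq_pos_of_pos [Nonempty V] {x : V → ℝ} (hx : ∀ v, 0 < x v) : 0 < ∑ v, x v ^ 2 :=
  Finset.sum_pos (fun v _ => pow_pos (hx v) 2) Finset.univ_nonempty

/-- If the quadratic form of `H` at the Perron vector of `G` is at least that of `G`, and this
vector is not an eigenvector of `H` in the same way, then `H` has larger spectral radius. -/
lemma spectralRadius_lt_of_adjForm_le [Nonempty V] {G H : SimpleGraph V} {x : V → ℝ}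
    (hx : ∀ v, 0 < x v) (hG : ∀ u, nbrSum G x u = G.spectralRadius * x u)
    (hle : adjForm G x ≤ adjForm H x) (hne : ∃ u, nbrSum H x u ≠ nbrSum G x u) :
    G.spectralRadius < H.spectralRadius := by
  have hs := sum_sq_pos_of_pos hx
  have h1 := adjForm_eq_of_nbrSum_eq hG
  have h2 := adjForm_le H x
  refine lt_of_le_of_ne (le_of_mul_le_mul_right (by linarith) hs) fun he => ?_
  obtain ⟨u, hu⟩ := hne
  refine hu ?_
  rw [hG u, he]
  exact nbrSum_eq_of_adjForm_eq H x (le_antisymm h2 (by rw [← he]; linarith)) u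

lemma spectralRadius_lt_of_adjForm_lt [Nonempty V] {G H : SimpleGraph V} {x : V → ℝ}
    (hx : ∀ v, 0 < x v) (hG : ∀ u, nbrSum G x u = G.spectralRadius * x u)
    (hlt : adjForm G x < adjForm H x) : G.spectralRadius < H.spectralRadius := by
  refine spectralRadius_lt_of_adjForm_le hx hG hlt.le ?_
  by_contra! h
  exact hlt.ne (Finset.sum_congr rfl fun u _ => by rw [h u])

lemma nbrSum_mono {G H : SimpleGraph V} (hGH : G ≤ H) {x : V → ℝ} (hx : ∀ v, 0 < x v) (u : V) :
    nbrSum G x u ≤ nbrSum H x u := by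
  refine Finset.sum_le_sum fun v _ => ?_
  by_cases h : G.Adj u v
  · simp [h, hGH h]
  · rw [if_neg h]
    split_ifs
    exacts [(hx v).le, le_rfl]

lemma spectralRadius_lt_of_lt {G H : SimpleGraph V} (hG : G.Connected) (hGH : G < H) :
    G.spectralRadius < H.spectralRadius := by
  have := hG.nonempty
  obtain ⟨x, hx, hxe⟩ := exists_pos_eigenvector hG
  refine spectralRadius_lt_of_adjForm_le hx hxe (Finset.sum_le_sum fun u _ =>
    mul_le_mul_of_nonneg_left (nbrSum_mono hGH.le hx u) (hx u).le) ?_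
  obtain ⟨u, v, huv, hn⟩ : ∃ u v, H.Adj u v ∧ ¬ G.Adj u v := by
    by_contra! h
    exact hGH.not_ge fun u v => h u v
  refine ⟨u, (Finset.sum_lt_sum (fun z _ => ?_) ⟨v, Finset.mem_univ v, ?_⟩).ne'⟩
  · by_cases h : G.Adj u z
    · simp [h, hGH.le h]
    · rw [if_neg h]
      split_ifs
      exacts [(hx z).le, le_rfl]
  · simp [huv, hn, hx v]

lemma spectralRadius_le_of_le {G H : SimpleGraph V} (hG : G.Connected) (hGH : G ≤ H) :
    G.spectralRadius ≤ H.spectralRadius := by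
  rcases hGH.eq_or_lt with rfl | h
  exacts [le_rfl, (spectralRadius_lt_of_lt hG h).le]

lemma spectralRadius_le_of_iso [Nonempty V] {G : SimpleGraph V} {H : SimpleGraph W} (e : G ≃g H) :
    G.spectralRadius ≤ H.spectralRadius := by
  obtain ⟨x, hx0, hx⟩ := exists_eigenvector G
  have h1 := adjForm_eq_of_nbrSum_eq hx
  have h2 := adjForm_le H (x ∘ e.symm)
  have h3 : adjForm H (x ∘ e.symm) = adjForm G x := by
    simp only [adjForm, nbrSum]
    refine (Fintype.sum_equiv e.toEquiv _ _ fun u => ?_).symm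
    congr 1
    · simp
    · refine Fintype.sum_equiv e.toEquiv _ _ fun v => ?_
      have h : H.Adj (e u) (e v) ↔ G.Adj u v := e.map_adj_iff
      simp [h]
  have h4 : ∑ v, (x ∘ e.symm) v ^ 2 = ∑ v, x v ^ 2 :=
    (Fintype.sum_equiv e.toEquiv _ _ fun u => by simp).symm
  have hs : 0 < ∑ v, x v ^ 2 := by
    obtain ⟨u, hu⟩ := Function.ne_iff.1 hx0
    exact Finset.sum_pos' (fun _ _ => sq_nonneg _) ⟨u, Finset.mem_univ u, by
      have : x u ≠ 0 := hu
      positivity⟩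
  rw [h3, h4, h1] at h2
  exact le_of_mul_le_mul_right h2 hs

lemma spectralRadius_eq_of_iso [Nonempty V] {G : SimpleGraph V} {H : SimpleGraph W} (e : G ≃g H) :
    G.spectralRadius = H.spectralRadius :=
  have : Nonempty W := e.symm.toEquiv.nonempty
  le_antisymm (spectralRadius_le_of_iso e) (spectralRadius_le_of_iso e.symm)

/-- The change of the quadratic form when only edges at `a` change. -/
lemma adjForm_sub_adjForm_of_forall_ne {G H : SimpleGraph V} {a : V}
    (h : ∀ u v, u ≠ a → v ≠ a → (H.Adj u v ↔ G.Adj u v)) (x : V → ℝ) :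
    adjForm H x - adjForm G x = 2 * x a * (nbrSum H x a - nbrSum G x a) := by
  have hrow : ∀ u, u ≠ a → nbrSum H x u - nbrSum G x u =
      ((if H.Adj a u then x a else 0) - if G.Adj a u then x a else 0) := by
    intro u hu
    simp only [nbrSum, ← Finset.sum_sub_distrib]
    rw [Finset.sum_eq_single a]
    · simp only [SimpleGraph.adj_comm]
    · intro v _ hv
      simp [h u v hu hv]
    · simp
  simp only [adjForm, ← Finset.sum_sub_distrib, ← mul_sub]
  rw [← Finset.add_sum_erase _ _ (Finset.mem_univ a),
    Finset.sum_congr rfl fun u hu => by rw [hrow u (Finset.ne_of_mem_erase hu)]]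
  have hself : nbrSum H x a - nbrSum G x a = ∑ u ∈ Finset.univ.erase a,
      ((if H.Adj a u then x u else 0) - if G.Adj a u then x u else 0) := by
    simp only [nbrSum, ← Finset.sum_sub_distrib]
    rw [← Finset.add_sum_erase _ _ (Finset.mem_univ a)]
    simp
  have hrest : ∑ u ∈ Finset.univ.erase a,
      x u * ((if H.Adj a u then x a else 0) - if G.Adj a u then x a else 0) =
      x a * (nbrSum H x a - nbrSum G x a) := by
    rw [hself, Finset.mul_sum]
    refine Finset.sum_congr rfl fun u _ => ?_
    split_ifs <;> ring
  rw [hrest]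
  ring

/-- The change of the quadratic form when only edges at `a` and at `b` change, the adjacency of
`a` and `b` being kept. -/
lemma adjForm_sub_adjForm {G H : SimpleGraph V} {a b : V} (hab : a ≠ b)
    (hadj : H.Adj a b ↔ G.Adj a b)
    (h : ∀ u v, u ≠ a → u ≠ b → v ≠ a → v ≠ b → (H.Adj u v ↔ G.Adj u v)) (x : V → ℝ) :
    adjForm H x - adjForm G x = 2 * x a * (nbrSum H x a - nbrSum G x a) +
      2 * x b * (nbrSum H x b - nbrSum G x b) := by
  set D : V → V → ℝ := fun u v => (if H.Adj u v then 1 else 0) - (if G.Adj u v then 1 else 0)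
    with hD
  have hrow : ∀ u, nbrSum H x u - nbrSum G x u = ∑ v, D u v * x v := by
    intro u
    simp only [nbrSum, ← Finset.sum_sub_distrib, hD]
    refine Finset.sum_congr rfl fun v _ => ?_
    split_ifs <;> simp
  have hsymm : ∀ u v, D u v = D v u := by
    intro u v
    simp only [hD, SimpleGraph.adj_comm]
  have hDaa : ∀ u, D u u = 0 := by intro u; simp [hD]
  have hDab : D a b = 0 := by simp [hD, hadj]
  have hD0 : ∀ u v, u ≠ a → u ≠ b → v ≠ a → v ≠ b → D u v = 0 := by
    intro u v h1 h2 h3 h4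
    simp [hD, h u v h1 h2 h3 h4]
  have hother : ∀ u, u ≠ a → u ≠ b → ∑ v, D u v * x v = D u a * x a + D u b * x b := by
    intro u h1 h2
    rw [← Finset.sum_pair hab (f := fun v => D u v * x v)]
    refine (Finset.sum_subset (Finset.subset_univ _) fun v _ hv => ?_).symm
    simp only [Finset.mem_insert, Finset.mem_singleton, not_or] at hv
    rw [hD0 u v h1 h2 hv.1 hv.2, zero_mul]
  have hsplit : ∀ f : V → ℝ, ∑ u, f u = f a + f b + ∑ u ∈ (Finset.univ \ {a, b}), f u := by
    intro f
    rw [← Finset.sum_pair hab, add_comm, Finset.sum_sdiff (Finset.subset_univ _)]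
  have hlhs : adjForm H x - adjForm G x = ∑ u, x u * ∑ v, D u v * x v := by
    simp only [adjForm, ← Finset.sum_sub_distrib, ← mul_sub, hrow]
  have hba : D b a = 0 := by rw [hsymm, hDab]
  rw [hlhs, hrow a, hrow b, hsplit]
  have hrest : ∑ u ∈ (Finset.univ \ {a, b}), x u * ∑ v, D u v * x v =
      x a * ∑ v, D a v * x v + x b * ∑ v, D b v * x v := by
    rw [hsplit fun v => D a v * x v, hsplit fun v => D b v * x v, hDaa, hDaa, hDab, hba]
    simp only [zero_mul, zero_add, Finset.mul_sum, ← Finset.sum_add_distrib]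
    refine Finset.sum_congr rfl fun u hu => ?_
    simp only [Finset.mem_sdiff, Finset.mem_univ, true_and, Finset.mem_insert,
      Finset.mem_singleton, not_or] at hu
    rw [← Finset.mul_sum, hother u hu.1 hu.2, hsymm u a, hsymm u b]
    ring
  rw [hrest]
  ring

end Spectral

section LowGraph

open Classical

variable {V ι : Type*} [Fintype V]

/-- The graph on `V` in which `w` has neighbourhood `N`, and two other vertices are adjacent if one
of them has colour `none` or both have the same colour. -/
def lowGraph (c : V → Option ι) (w : V) (N : Finset V) : SimpleGraph V where
  Adj u v := u ≠ v ∧ ((u = w ∧ v ∈ N) ∨ (v = w ∧ u ∈ N) ∨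
    (u ≠ w ∧ v ≠ w ∧ (c u = none ∨ c v = none ∨ c u = c v)))
  symm := ⟨by
    rintro u v ⟨hne, h⟩
    refine ⟨hne.symm, ?_⟩
    rcases h with h | h | ⟨h1, h2, h3⟩
    · exact Or.inr (Or.inl h)
    · exact Or.inl h
    · exact Or.inr (Or.inr ⟨h2, h1, by
        rcases h3 with h3 | h3 | h3
        exacts [Or.inr (Or.inl h3), Or.inl h3, Or.inr (Or.inr h3.symm)]⟩)⟩
  loopless := ⟨fun _ h => h.1 rfl⟩

/-- The sum of `x` over the vertices other than `w` that are coloured `none` or `some i`. -/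
noncomputable def partSum (c : V → Option ι) (w : V) (x : V → ℝ) (i : ι) : ℝ :=
  ∑ v, if v ≠ w ∧ (c v = none ∨ c v = some i) then x v else 0

/-- The sum of `x` over the vertices other than `w`. -/
noncomputable def totalSum (w : V) (x : V → ℝ) : ℝ :=
  ∑ v, if v ≠ w then x v else 0

variable {c : V → Option ι} {w : V} {N : Finset V} {x : V → ℝ}

lemma sum_eq_sum_ite_mem (N : Finset V) (x : V → ℝ) :
    ∑ v ∈ N, x v = ∑ v, if v ∈ N then x v else 0 := by
  simp

lemma nbrSum_lowGraph_self (hw : w ∉ N) : nbrSum (lowGraph c w N) x w = ∑ v ∈ N, x v := by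
  rw [sum_eq_sum_ite_mem]
  refine Finset.sum_congr rfl fun v _ => ?_
  by_cases hv : v = w
  · subst hv
    simp [hw]
  · simp [lowGraph, hv, Ne.symm hv]

lemma nbrSum_lowGraph_none {u : V} (hw : w ∉ N) (hu : u ≠ w) (hc : c u = none) :
    nbrSum (lowGraph c w N) x u = totalSum w x - x u + if u ∈ N then x w else 0 := by
  have h : ∀ v, (if (lowGraph c w N).Adj u v then x v else 0) = (if v ≠ w then x v else 0) -
      (if v = u then x v else 0) + if v = w then (if u ∈ N then x v else 0) else 0 := by
    intro v
    by_cases hvw : v = w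
    · subst hvw
      simp [lowGraph, hu, hu.symm]
    · by_cases hvu : v = u
      · subst hvu
        simp [hu]
      · simp [lowGraph, hvw, hvu, hu, hc, Ne.symm hvu]
  simp only [nbrSum, h, Finset.sum_add_distrib, Finset.sum_sub_distrib, totalSum]
  simp

lemma nbrSum_lowGraph_some {u : V} {i : ι} (hw : w ∉ N) (hu : u ≠ w) (hc : c u = some i) :
    nbrSum (lowGraph c w N) x u = partSum c w x i - x u + if u ∈ N then x w else 0 := by
  have h : ∀ v, (if (lowGraph c w N).Adj u v then x v else 0) =
      (if v ≠ w ∧ (c v = none ∨ c v = some i) then x v else 0) -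
      (if v = u then x v else 0) + if v = w then (if u ∈ N then x v else 0) else 0 := by
    intro v
    by_cases hvw : v = w
    · subst hvw
      simp [lowGraph, hu, hu.symm]
    · by_cases hvu : v = u
      · subst hvu
        simp [hu, hc]
      · simp [lowGraph, hvw, hvu, hu, hc, Ne.symm hvu, eq_comm (a := some i)]
  simp only [nbrSum, h, Finset.sum_add_distrib, Finset.sum_sub_distrib, partSum]
  simp

lemma card_filter_comp_swap (c : V → Option ι) (a b : V) (o : Option ι) :
    (Finset.univ.filter fun v => (c ∘ Equiv.swap a b) v = o).card =
      (Finset.univ.filter fun v => c v = o).card :=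
  Finset.card_equiv (Equiv.swap a b) fun v => by simp

lemma lowGraph_le_of_subset {N' : Finset V} (h : N ⊆ N') : lowGraph c w N ≤ lowGraph c w N' := by
  rintro u v ⟨h1, h2⟩
  refine ⟨h1, ?_⟩
  rcases h2 with h2 | h2 | h2
  exacts [Or.inl ⟨h2.1, h h2.2⟩, Or.inr (Or.inl ⟨h2.1, h h2.2⟩), Or.inr (Or.inr h2)]

/-- Configurations in which the vertex `w` lies in one of the parts: `κ` vertices are coloured
`none`, every part has more than `h` vertices, and `w` has at most `δ` neighbours, all of them
coloured `none` or in the part of `w`, and at least one of the latter kind. -/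
structure IsLowConfig (h κ δ : ℕ) (c : V → Option ι) (w : V) (N : Finset V) : Prop where
  top : (Finset.univ.filter fun v => c v = none).card = κ
  part : ∀ i, h + 1 ≤ (Finset.univ.filter fun v => c v = some i).card
  color : c w ≠ none
  notMem : w ∉ N
  sub : ∀ v ∈ N, c v = none ∨ c v = c w
  meet : ∃ v ∈ N, c v = c w
  card_le : N.card ≤ δ

variable {h κ δ : ℕ}

lemma exists_mem_part_ne (hh : 1 ≤ h)
    (hpart : ∀ i, h + 1 ≤ (Finset.univ.filter fun v => c v = some i).card) (i : ι) (q : V) :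
    ∃ p, c p = some i ∧ p ≠ q := by
  obtain ⟨p, hp, hpq⟩ := Finset.exists_mem_ne (show 1 < (Finset.univ.filter
    fun v => c v = some i).card by have := hpart i; omega) q
  exact ⟨p, by simpa using hp, hpq⟩

namespace IsLowConfig

lemma exists_top_notMem (hv : IsLowConfig h κ δ c w N)
    (hlt : (N.filter fun v => c v = none).card < κ) : ∃ t, c t = none ∧ t ∉ N ∧ t ≠ w := by
  obtain ⟨t, ht, htN⟩ := Finset.exists_mem_notMem_of_card_lt_card (hlt.trans_eq hv.top.symm)
  simp only [Finset.mem_filter, Finset.mem_univ, true_and] at ht htN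
  exact ⟨t, ht, fun h => htN ⟨h, ht⟩, fun h => hv.color (h ▸ ht)⟩

lemma connected (hv : IsLowConfig h κ δ c w N) (hκ : 1 ≤ κ) : (lowGraph c w N).Connected := by
  obtain ⟨t, ht⟩ := Finset.card_pos.1 (hκ.trans_eq hv.top.symm)
  simp only [Finset.mem_filter, Finset.mem_univ, true_and] at ht
  have htw : t ≠ w := fun h => hv.color (h ▸ ht)
  have hreach : ∀ u, u ≠ w → (lowGraph c w N).Reachable u t := by
    intro u hu
    by_cases hut : u = t
    · rw [hut]
    · have ha : (lowGraph c w N).Adj u t :=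
        ⟨hut, Or.inr (Or.inr ⟨hu, htw, Or.inr (Or.inl ht)⟩)⟩
      exact ha.reachable
  obtain ⟨b, hb, -⟩ := hv.meet
  have hbw : b ≠ w := fun h => hv.notMem (h ▸ hb)
  have hall : ∀ u, (lowGraph c w N).Reachable u t := by
    intro u
    by_cases hu : u = w
    · subst hu
      have ha : (lowGraph c u N).Adj u b := ⟨hbw.symm, Or.inl ⟨rfl, hb⟩⟩
      exact ha.reachable.trans (hreach b hbw)
    · exact hreach u hu
  have : Nonempty V := ⟨w⟩
  exact ⟨fun u v => (hall u).trans (hall v).symm⟩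

lemma exists_lt_of_card_lt (hv : IsLowConfig h κ δ c w N) (hκ : 1 ≤ κ) (hδκ : δ ≤ κ)
    (hlt : N.card < δ) : ∃ N' : Finset V, IsLowConfig h κ δ c w N' ∧
      (lowGraph c w N).spectralRadius < (lowGraph c w N').spectralRadius := by
  obtain ⟨t, ht, htN, htw⟩ := hv.exists_top_notMem
    (lt_of_le_of_lt (Finset.card_filter_le _ _) (by omega))
  refine ⟨insert t N, ⟨hv.top, hv.part, hv.color, ?_, ?_, ?_, ?_⟩,
    spectralRadius_lt_of_lt (hv.connected hκ) (lt_of_le_not_ge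
      (lowGraph_le_of_subset (Finset.subset_insert _ _)) fun hle => ?_)⟩
  · simp [htw.symm, hv.notMem]
  · intro v hvN
    rcases Finset.mem_insert.1 hvN with rfl | hvN
    exacts [Or.inl ht, hv.sub v hvN]
  · obtain ⟨b, hb, hbw⟩ := hv.meet
    exact ⟨b, Finset.mem_insert_of_mem hb, hbw⟩
  · rw [Finset.card_insert_of_notMem htN]
    omega
  · have h1 : (lowGraph c w (insert t N)).Adj w t := ⟨htw.symm, Or.inl ⟨rfl, by simp⟩⟩
    obtain ⟨-, h2 | h2 | h2⟩ := hle h1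
    exacts [htN h2.2, htw h2.1, h2.1 rfl]

lemma exists_lt_of_two_mem (hv : IsLowConfig h κ δ c w N) [Nontrivial ι] (hκ : 1 ≤ κ)
    (hδκ : δ ≤ κ) {b b' : V} (hb : b ∈ N) (hb' : b' ∈ N) (hbb' : b ≠ b') (hbw : c b = c w)
    (hbw' : c b' = c w) (hh : 1 ≤ h) : ∃ (c' : V → Option ι) (N' : Finset V), IsLowConfig h κ δ c' w N' ∧
      (lowGraph c w N).spectralRadius < (lowGraph c' w N').spectralRadius := by
  have hV : Nonempty V := ⟨w⟩
  obtain ⟨x, hx, hxe⟩ := exists_pos_eigenvector (hv.connected hκ)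
  have hw := hv.notMem
  have hb'w : b' ≠ w := fun h => hw (h ▸ hb')
  have hbnw : b ≠ w := fun h => hw (h ▸ hb)
  obtain ⟨i, hi⟩ := Option.ne_none_iff_exists'.1 hv.color
  obtain ⟨t, ht, htN, htw⟩ := hv.exists_top_notMem (by
    refine lt_of_lt_of_le (Finset.card_lt_card (Finset.filter_ssubset.2 ⟨b, hb, ?_⟩))
      (hv.card_le.trans hδκ)
    rw [hbw]
    exact hv.color)
  have htb' : t ≠ b' := fun h => htN (h ▸ hb')
  have htb : t ≠ b := fun h => htN (h ▸ hb)
  rcases le_or_gt (x b') (x t) with hle | hlt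
  · have hwN' : w ∉ insert t (N.erase b') := by simp [htw.symm, hw]
    have hsum : ∑ v ∈ insert t (N.erase b'), x v = ∑ v ∈ N, x v - x b' + x t := by
      rw [Finset.sum_insert (by simp [htN]), ← Finset.add_sum_erase _ _ hb']
      ring
    refine ⟨c, insert t (N.erase b'), ⟨hv.top, hv.part, hv.color, hwN', ?_,
      ⟨b, by simp [hbb', hb], hbw⟩, ?_⟩, spectralRadius_lt_of_adjForm_le hx hxe ?_ ⟨t, ?_⟩⟩
    · intro v hvN
      rcases Finset.mem_insert.1 hvN with rfl | hvN
      exacts [Or.inl ht, hv.sub v (Finset.mem_of_mem_erase hvN)]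
    · rw [Finset.card_insert_of_notMem (by simp [htN]), Finset.card_erase_add_one hb']
      exact hv.card_le
    · have h1 := adjForm_sub_adjForm_of_forall_ne (G := lowGraph c w N)
        (H := lowGraph c w (insert t (N.erase b'))) (a := w)
        (fun u v hu hv => by simp [lowGraph, hu, hv]) x
      rw [nbrSum_lowGraph_self hw, nbrSum_lowGraph_self hwN', hsum] at h1
      have := mul_nonneg (mul_nonneg zero_le_two (hx w).le) (sub_nonneg.2 hle)
      linarith
    · rw [nbrSum_lowGraph_none hw htw ht, nbrSum_lowGraph_none hwN' htw ht]
      have := hx w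
      simp [htN, this.ne']
  · have hcw : (c ∘ Equiv.swap t b') w = c w := by
      simp [Equiv.swap_apply_of_ne_of_ne htw.symm hb'w.symm]
    have hct : (c ∘ Equiv.swap t b') t = some i := by simp [hbw', hi]
    have hcb' : (c ∘ Equiv.swap t b') b' = none := by simp [ht]
    have hcv : ∀ v, v ≠ t → v ≠ b' → (c ∘ Equiv.swap t b') v = c v := by
      intro v h1 h2
      simp [Equiv.swap_apply_of_ne_of_ne h1 h2]
    have hZ : partSum (c ∘ Equiv.swap t b') w x i = partSum c w x i := by
      refine Finset.sum_congr rfl fun v _ => ?_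
      by_cases hvt : v = t
      · subst hvt
        rw [hct, ht]
        simp
      by_cases hvb : v = b'
      · subst hvb
        rw [hcb', hbw', hi]
        simp
      rw [hcv v hvt hvb]
    refine ⟨c ∘ Equiv.swap t b', N, ⟨?_, ?_, by rw [hcw]; exact hv.color, hw, ?_,
      ⟨b, hb, by rw [hcw, hcv b htb.symm hbb', hbw]⟩, hv.card_le⟩,
      spectralRadius_lt_of_adjForm_lt hx hxe ?_⟩
    · rw [card_filter_comp_swap, hv.top]
    · intro j
      rw [card_filter_comp_swap]
      exact hv.part j
    · intro v hvN
      have hvt : v ≠ t := fun h => htN (h ▸ hvN)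
      by_cases hvb : v = b'
      · exact Or.inl (hvb ▸ hcb')
      · rw [hcw, hcv v hvt hvb]
        exact hv.sub v hvN
    · have h1 := adjForm_sub_adjForm (G := lowGraph c w N)
        (H := lowGraph (c ∘ Equiv.swap t b') w N) htb' (by
          simp only [lowGraph, hct, hcb', ht]
          simp) (fun u v h1 h2 h3 h4 => by
          simp only [lowGraph, hcv u h1 h2, hcv v h3 h4]) x
      rw [nbrSum_lowGraph_none hw htw ht, nbrSum_lowGraph_some hw hb'w (hbw'.trans hi),
        nbrSum_lowGraph_some hw htw hct, nbrSum_lowGraph_none hw hb'w hcb', hZ] at h1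
      have h2 : partSum c w x i < totalSum w x := by
        obtain ⟨j, hj⟩ := exists_ne i
        obtain ⟨p, hp, hpw⟩ := exists_mem_part_ne hh hv.part j w
        refine Finset.sum_lt_sum (fun v _ => ?_) ⟨p, Finset.mem_univ _, ?_⟩
        · have := (hx v).le
          split_ifs <;> simp_all
        · simp [hp, hpw, hj, hx p]
      have h3 := mul_pos (sub_pos.2 hlt) (sub_pos.2 h2)
      nlinarith

/-- Moving a vertex from a part to a part of at least the same weight. -/
lemma exists_lt_of_partSum_le (hv : IsLowConfig h κ δ c w N) (hh : 1 ≤ h)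
    (hb : ∀ b ∈ N, ∀ b' ∈ N, c b = c w → c b' = c w → b = b')
    (hx : ∀ v, 0 < x v)
    (hxe : ∀ u, nbrSum (lowGraph c w N) x u = (lowGraph c w N).spectralRadius * x u)
    {i j : ι} (hij : i ≠ j) (hle : partSum c w x i ≤ partSum c w x j)
    (hi : h + 2 ≤ (Finset.univ.filter fun v => c v = some i).card) :
    ∃ c' : V → Option ι, IsLowConfig h κ δ c' w N ∧
      (lowGraph c w N).spectralRadius < (lowGraph c' w N).spectralRadius := by
  have hV : Nonempty V := ⟨w⟩
  have hw := hv.notMem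
  obtain ⟨b, hbN, hbw⟩ := hv.meet
  obtain ⟨v, hvi, hvwb⟩ := Finset.exists_mem_notMem_of_card_lt_card
    (lt_of_le_of_lt (Finset.card_le_two (a := w) (b := b)) (lt_of_lt_of_le (by omega) hi))
  simp only [Finset.mem_filter, Finset.mem_univ, true_and, Finset.mem_insert,
    Finset.mem_singleton, not_or] at hvi hvwb
  obtain ⟨hvw, hvb⟩ := hvwb
  have hvN : v ∉ N := by
    intro hvN
    rcases hv.sub v hvN with h1 | h1
    · simp [hvi] at h1
    · exact hvb (hb v hvN b hbN h1 hbw)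
  set c' := Function.update c v (some j) with hc'
  have hcv : c' v = some j := by simp [hc']
  have hcu : ∀ u, u ≠ v → c' u = c u := fun u hu => by simp [hc', hu]
  refine ⟨c', ⟨?_, fun k => ?_, ?_, hw, ?_, ⟨b, hbN, ?_⟩, hv.card_le⟩,
    spectralRadius_lt_of_adjForm_lt hx hxe ?_⟩
  · rw [← hv.top]
    congr 1
    ext u
    by_cases hu : u = v
    · simp [hu, hcv, hvi]
    · simp [hcu u hu]
  · by_cases hk : k = i
    · subst hk
      have h1 : (Finset.univ.filter fun u => c u = some k).erase v ⊆
          Finset.univ.filter fun u => c' u = some k := by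
        intro u hu
        simp only [Finset.mem_erase, Finset.mem_filter, Finset.mem_univ, true_and] at hu ⊢
        rw [hcu u hu.1, hu.2]
      have h2 := Finset.card_le_card h1
      rw [Finset.card_erase_of_mem (by simp [hvi])] at h2
      omega
    · refine (hv.part k).trans (Finset.card_le_card fun u hu => ?_)
      simp only [Finset.mem_filter, Finset.mem_univ, true_and] at hu ⊢
      rw [hcu u, hu]
      rintro rfl
      rw [hvi] at hu
      exact hk (Option.some_injective _ hu).symm
  · rw [hcu w (Ne.symm hvw)]
    exact hv.color
  · intro u hu
    rw [hcu w (Ne.symm hvw), hcu u fun h => hvN (h ▸ hu)]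
    exact hv.sub u hu
  · rw [hcu w (Ne.symm hvw), hcu b (Ne.symm hvb), hbw]
  · have h1 := adjForm_sub_adjForm_of_forall_ne (G := lowGraph c w N) (H := lowGraph c' w N)
      (a := v) (fun u z hu hz => by simp only [lowGraph, hcu u hu, hcu z hz]) x
    have hZ : partSum c' w x j = partSum c w x j + x v := by
      have h2 : ∀ u, (if u ≠ w ∧ (c' u = none ∨ c' u = some j) then x u else 0) =
          (if u ≠ w ∧ (c u = none ∨ c u = some j) then x u else 0) +
          if u = v then x u else 0 := by
        intro u
        by_cases hu : u = v
        · subst hu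
          simp [hcv, hvi, hvw, hij]
        · simp [hcu u hu, hu]
      simp only [partSum, h2, Finset.sum_add_distrib]
      simp
    rw [nbrSum_lowGraph_some hw hvw hvi, nbrSum_lowGraph_some hw hvw hcv, hZ] at h1
    simp only [hvN, if_false] at h1
    have := mul_pos (hx v) (show 0 < partSum c w x j - partSum c w x i + x v by
      linarith [hx v])
    nlinarith

/-- Exchanging the part of `w`, if it is heavier, with another part. -/
lemma exists_lt_of_partSum_lt (hv : IsLowConfig h κ δ c w N) (hδκ : δ ≤ κ)
    (hh : 1 ≤ h) (hb : ∀ b ∈ N, ∀ b' ∈ N, c b = c w → c b' = c w → b = b')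
    (hx : ∀ v, 0 < x v)
    (hxe : ∀ u, nbrSum (lowGraph c w N) x u = (lowGraph c w N).spectralRadius * x u)
    {i j : ι} (hi : c w = some i) (hlt : partSum c w x j < partSum c w x i) :
    ∃ (c' : V → Option ι) (N' : Finset V), IsLowConfig h κ δ c' w N' ∧
      (lowGraph c w N).spectralRadius < (lowGraph c' w N').spectralRadius := by
  have hV : Nonempty V := ⟨w⟩
  have hw := hv.notMem
  have hij : i ≠ j := by rintro rfl; exact lt_irrefl _ hlt
  obtain ⟨b, hbN, hbw⟩ := hv.meet
  have hbnw : b ≠ w := fun h => hw (h ▸ hbN)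
  obtain ⟨t, ht, htN, htw⟩ := hv.exists_top_notMem (by
    refine lt_of_lt_of_le (Finset.card_lt_card (Finset.filter_ssubset.2 ⟨b, hbN, ?_⟩))
      (hv.card_le.trans hδκ)
    rw [hbw]
    exact hv.color)
  obtain ⟨p, hp, hpw⟩ := exists_mem_part_ne hh hv.part j w
  obtain ⟨q, hq, hqp⟩ := exists_mem_part_ne hh hv.part j p
  have hbi : c b = some i := hbw.trans hi
  have hnot : ∀ u, c u = some j → u ≠ w ∧ u ∉ N ∧ u ≠ b ∧ u ≠ t := by
    intro u hu
    refine ⟨?_, fun huN => ?_, ?_, ?_⟩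
    · rintro rfl
      exact hij (Option.some_injective _ (hi.symm.trans hu))
    · rcases hv.sub u huN with h1 | h1
      · simp [hu] at h1
      · exact hij (Option.some_injective _ (hi.symm.trans (h1.symm.trans hu)))
    · rintro rfl
      exact hij (Option.some_injective _ (hbi.symm.trans hu))
    · rintro rfl
      simp [hu] at ht
  obtain ⟨-, hpN, hpb, hpt⟩ := hnot p hp
  obtain ⟨hqw, hqN, hqb, hqt⟩ := hnot q hq
  have htop : ∀ v ∈ N, v ≠ b → c v = none := by
    intro v hvN hvb
    rcases hv.sub v hvN with h1 | h1
    exacts [h1, absurd (hb v hvN b hbN h1 hbw) hvb]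
  have htb : t ≠ b := fun h => htN (h ▸ hbN)
  set ρ := (lowGraph c w N).spectralRadius
  have ep := hxe p
  have eq := hxe q
  have eb := hxe b
  have et := hxe t
  have ew := hxe w
  rw [nbrSum_lowGraph_some hw hpw hp, if_neg hpN] at ep
  rw [nbrSum_lowGraph_some hw hqw hq, if_neg hqN] at eq
  rw [nbrSum_lowGraph_some hw hbnw hbi, if_pos hbN] at eb
  rw [nbrSum_lowGraph_none hw htw ht, if_neg htN] at et
  rw [nbrSum_lowGraph_self hw] at ew
  have hwj : ∑ v ∈ N, x v + x t + x p + x q ≤ partSum c w x j + x b := by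
    have h1 : ∀ v, (if v ∈ N then x v else 0) + (if v = t then x v else 0) +
        (if v = p then x v else 0) + (if v = q then x v else 0) ≤
        (if v ≠ w ∧ (c v = none ∨ c v = some j) then x v else 0) +
        if v = b then x v else 0 := by
      intro v
      have := (hx v).le
      by_cases h1 : v = t
      · subst h1
        simp [htN, hpt.symm, hqt.symm, htb, htw, ht]
      by_cases h2 : v = p
      · subst h2
        simp [hpN, hpt, hqp.symm, hpb, hpw, hp]
      by_cases h3 : v = q
      · subst h3
        simp [hqN, hqt, hqp, hqb, hqw, hq]
      by_cases h4 : v = b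
      · subst h4
        simp [hbN, h1, h2, h3, hbi, hij]
      by_cases h5 : v ∈ N
      · have h6 : v ≠ w := fun h => hw (h ▸ h5)
        simp [h1, h2, h3, h4, h5, h6, htop v h5 h4]
      · simp only [h1, h2, h3, h4, h5, if_false]
        split_ifs <;> simp [this]
    have h2 := Finset.sum_le_sum fun v (_ : v ∈ Finset.univ) => h1 v
    simp only [Finset.sum_add_distrib] at h2
    rw [← sum_eq_sum_ite_mem] at h2
    simpa [partSum] using h2
  have htot : partSum c w x i + x p ≤ totalSum w x := by
    have h1 : ∀ v, (if v ≠ w ∧ (c v = none ∨ c v = some i) then x v else 0) +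
        (if v = p then x v else 0) ≤ if v ≠ w then x v else 0 := by
      intro v
      have := (hx v).le
      by_cases h1 : v = p
      · subst h1
        simp [hp, hpw, hij.symm]
      · simp only [h1, if_false]
        split_ifs <;> simp_all
    have h2 := Finset.sum_le_sum fun v (_ : v ∈ Finset.univ) => h1 v
    simp only [Finset.sum_add_distrib] at h2
    simpa [partSum, totalSum] using h2
  have hxp := hx p
  have hxw := hx w
  have hxq := hx q
  have hxb := hx b
  have hxt := hx t
  have hNpos : 0 < ∑ v ∈ N, x v := Finset.sum_pos (fun v _ => hx v) ⟨b, hbN⟩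
  have hρ0 : 0 < ρ := by
    by_contra! h0
    nlinarith
  have hpq : x p = x q := by
    have : (ρ + 1) * (x p - x q) = 0 := by linarith
    rcases mul_eq_zero.1 this with h0 | h0 <;> linarith
  have hNb : x b ≤ ∑ v ∈ N, x v := Finset.single_le_sum (fun v _ => (hx v).le) hbN
  have hρ1 : 1 < ρ := by
    by_contra! h0
    nlinarith
  have hbt : (ρ + 1) * (x b - x t) ≤ x w - x p := by linarith
  have hwp : x w ≤ x p := by
    have h1 : ρ * (x w - x p) ≤ x b - x t - x p := by linarith
    by_contra! h2
    have h3 := mul_le_mul_of_nonneg_left h1 (show 0 ≤ ρ + 1 by linarith)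
    have h5 : 1 ≤ (ρ + 1) * ρ := by nlinarith
    have h4 : x w - x p ≤ (ρ + 1) * (ρ * (x w - x p)) := by
      nlinarith [mul_le_mul_of_nonneg_right h5 (sub_nonneg.2 h2.le)]
    nlinarith
  set g := partSum c w x i - partSum c w x j with hg
  have hg0 : 0 < g := sub_pos.2 hlt
  have hgain : 0 < x p * (g + x p) - x w * (x b - x q) := by
    have h1 : (ρ + 1) * (x b - x q) = g + x w := by linarith
    have h2 : (ρ + 1) * (x p * (g + x p) - x w * (x b - x q)) =
        (ρ + 1) * (x p * (g + x p)) - x w * (g + x w) := by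
      rw [← h1]
      ring
    have h3 : x w * (g + x w) ≤ x p * (g + x p) := by gcongr
    have h4 : 0 < x p * (g + x p) := by positivity
    refine pos_of_mul_pos_right (a := ρ + 1) ?_ (by linarith)
    rw [h2]
    nlinarith
  set c' := c ∘ Equiv.swap p w with hc'
  have hcp : c' p = some i := by simp [hc', hi]
  have hcw : c' w = some j := by simp [hc', hp]
  have hcv : ∀ v, v ≠ p → v ≠ w → c' v = c v := by
    intro v h1 h2
    simp [hc', Equiv.swap_apply_of_ne_of_ne h1 h2]
  have hwN' : w ∉ insert q (N.erase b) := by simp [hqw.symm, hw]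
  have hpN' : p ∉ insert q (N.erase b) := by simp [hqp.symm, hpN]
  have hsum : ∑ v ∈ insert q (N.erase b), x v = ∑ v ∈ N, x v - x b + x q := by
    rw [Finset.sum_insert (by simp [hqN]), ← Finset.add_sum_erase _ _ hbN]
    ring
  have hZ : partSum c' w x i = partSum c w x i + x p := by
    have h2 : ∀ u, (if u ≠ w ∧ (c' u = none ∨ c' u = some i) then x u else 0) =
        (if u ≠ w ∧ (c u = none ∨ c u = some i) then x u else 0) + if u = p then x u else 0 := by
      intro u
      by_cases hu : u = p
      · subst hu
        simp [hcp, hp, hpw, hij.symm]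
      · by_cases huw : u = w
        · simp [huw, hpw.symm]
        · simp [hcv u hu huw, hu]
    simp only [partSum, h2, Finset.sum_add_distrib]
    simp
  refine ⟨c', insert q (N.erase b), ⟨?_, fun k => ?_, by simp [hcw], hwN', fun v hvN => ?_,
    ⟨q, by simp, by rw [hcv q hqp hqw, hcw, hq]⟩, ?_⟩, spectralRadius_lt_of_adjForm_lt hx hxe ?_⟩
  · rw [card_filter_comp_swap, hv.top]
  · rw [card_filter_comp_swap]
    exact hv.part k
  · rcases Finset.mem_insert.1 hvN with rfl | hvN
    · exact Or.inr (by rw [hcv v hqp hqw, hcw, hq])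
    · obtain ⟨h1, h2⟩ := Finset.mem_erase.1 hvN
      exact Or.inl (by
        rw [hcv v (fun h => hpN (h ▸ h2)) fun h => hw (h ▸ h2), htop v h2 h1])
  · rw [Finset.card_insert_of_notMem (by simp [hqN]), Finset.card_erase_add_one hbN]
    exact hv.card_le
  · have h1 := adjForm_sub_adjForm (G := lowGraph c w N)
      (H := lowGraph c' w (insert q (N.erase b))) hpw (by
        simp only [lowGraph, hpN, hpN']
        simp [hpw]) (fun u v h1 h2 h3 h4 => by
        simp only [lowGraph, hcv u h1 h2, hcv v h3 h4, h2, h4]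
        simp) x
    rw [nbrSum_lowGraph_some hw hpw hp, nbrSum_lowGraph_some hwN' hpw hcp, if_neg hpN,
      if_neg hpN', nbrSum_lowGraph_self hw, nbrSum_lowGraph_self hwN', hsum, hZ] at h1
    rw [hg] at hgain
    linarith

end IsLowConfig

lemma card_add_four_le [Nontrivial ι] (hh : 1 ≤ h)
    (htop : (Finset.univ.filter fun v => c v = none).card = κ)
    (hpart : ∀ i, h + 1 ≤ (Finset.univ.filter fun v => c v = some i).card) :
    κ + 4 ≤ Fintype.card V := by
  obtain ⟨i, j, hij⟩ := exists_pair_ne ι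
  have h1 := Finset.card_le_univ ((Finset.univ.filter fun v => c v = none) ∪
    ((Finset.univ.filter fun v => c v = some i) ∪ Finset.univ.filter fun v => c v = some j))
  rw [Finset.card_union_of_disjoint, Finset.card_union_of_disjoint, htop] at h1
  · have h2 := hpart i
    have h3 := hpart j
    omega
  · rw [Finset.disjoint_left]
    intro v h2 h3
    simp_all
  · rw [Finset.disjoint_left]
    intro v h2 h3
    simp_all

lemma exists_isLowConfig_of_meet [Nontrivial ι] (hh : 1 ≤ h) (hδκ : δ ≤ κ)
    (hconn : (lowGraph c w N).Connected)
    (htop : (Finset.univ.filter fun v => c v = none).card = κ)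
    (hpart : ∀ i, h + 1 ≤ (Finset.univ.filter fun v => c v = some i).card)
    (hcw : c w = none) (hw : w ∉ N) (hcard : N.card ≤ δ) {q : V} {i : ι} (hqN : q ∈ N)
    (hq : c q = some i) : ∃ (c' : V → Option ι) (w' : V) (N' : Finset V),
      IsLowConfig h κ δ c' w' N' ∧
      (lowGraph c w N).spectralRadius < (lowGraph c' w' N').spectralRadius := by
  have hV : Nonempty V := ⟨w⟩
  obtain ⟨x, hx, hxe⟩ := exists_pos_eigenvector hconn
  obtain ⟨p, hp, hpq⟩ := exists_mem_part_ne hh hpart i q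
  have hpw : p ≠ w := by
    rintro rfl
    simp [hp] at hcw
  have hqw : q ≠ w := fun h => hw (h ▸ hqN)
  rcases le_or_gt (x w) (x p) with hle | hlt
  · set c' := c ∘ Equiv.swap p w with hc'
    have hcp : c' p = none := by simp [hc', hcw]
    have hcw' : c' w = some i := by simp [hc', hp]
    have hcv : ∀ v, v ≠ p → v ≠ w → c' v = c v := by
      intro v h1 h2
      simp [hc', Equiv.swap_apply_of_ne_of_ne h1 h2]
    set N' := N.filter fun v => c v = none ∨ c v = some i with hN'
    have hwN' : w ∉ N' := by simp [hN', hw]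
    have hpN' : p ∈ N' ↔ p ∈ N := by simp [hN', hp]
    obtain ⟨j, hj⟩ := exists_ne i
    obtain ⟨z, hz, hzw⟩ := exists_mem_part_ne hh hpart j w
    have htot : partSum c w x i < totalSum w x := by
      refine Finset.sum_lt_sum (fun v _ => ?_) ⟨z, Finset.mem_univ _, ?_⟩
      · have := (hx v).le
        split_ifs <;> simp_all
      · simp [hz, hzw, hj, hx z]
    have hsum : ∑ v ∈ N, x v + partSum c w x i ≤ ∑ v ∈ N', x v + totalSum w x := by
      rw [sum_eq_sum_ite_mem N, sum_eq_sum_ite_mem N', partSum, totalSum,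
        ← Finset.sum_add_distrib, ← Finset.sum_add_distrib]
      refine Finset.sum_le_sum fun v _ => ?_
      have := (hx v).le
      by_cases hvw : v = w
      · subst hvw
        simp [hw, hwN']
      · by_cases hvN : v ∈ N
        · by_cases hci : c v = none ∨ c v = some i <;> simp [hN', hvw, hvN, hci]
        · by_cases hci : c v = none ∨ c v = some i <;> simp [hN', hvw, hvN, hci, this]
    refine ⟨c', w, N', ⟨?_, fun k => ?_, by simp [hcw'], hwN', fun v hv => ?_,
      ⟨q, by simp [hN', hqN, hq], by rw [hcv q hpq.symm hqw, hcw', hq]⟩,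
      (Finset.card_filter_le _ _).trans hcard⟩, spectralRadius_lt_of_adjForm_le hx hxe ?_ ⟨p, ?_⟩⟩
    · rw [card_filter_comp_swap, htop]
    · rw [card_filter_comp_swap]
      exact hpart k
    · by_cases hvp : v = p
      · exact Or.inl (hvp ▸ hcp)
      · rw [hcv v hvp fun h => hwN' (h ▸ hv), hcw']
        exact (Finset.mem_filter.1 hv).2
    · have h1 := adjForm_sub_adjForm (G := lowGraph c w N) (H := lowGraph c' w N') hpw (by
          simp only [lowGraph, hpN']
          simp [hpw]) (fun u v h1 h2 h3 h4 => by
          simp only [lowGraph, hcv u h1 h2, hcv v h3 h4, h2, h4]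
          simp) x
      rw [nbrSum_lowGraph_some hw hpw hp, nbrSum_lowGraph_none hwN' hpw hcp,
        nbrSum_lowGraph_self hw, nbrSum_lowGraph_self hwN'] at h1
      simp only [hpN'] at h1
      have h2 := mul_nonneg (hx w).le (sub_nonneg.2 hsum)
      have h3 := mul_nonneg (sub_nonneg.2 hle) (sub_nonneg.2 htot.le)
      linarith
    · rw [nbrSum_lowGraph_some hw hpw hp, nbrSum_lowGraph_none hwN' hpw hcp]
      simp only [hpN']
      intro h
      linarith
  · set N' := Finset.univ.filter fun v => v ≠ p ∧
      ((v = w ∧ p ∈ N) ∨ (v ∈ N ∧ (c v = none ∨ c v = some i))) with hN'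
    have hwN' : w ∈ N' ↔ p ∈ N := by simp [hN', hw, hpw.symm]
    have hpN' : p ∉ N' := by simp [hN']
    obtain ⟨z, -, hz⟩ := Finset.exists_mem_notMem_of_card_lt_card
      (s := N ∪ {w, p}) (t := Finset.univ) (by
        have h1 := Finset.card_union_le N {w, p}
        have h2 := Finset.card_le_two (a := w) (b := p)
        have h3 := card_add_four_le hh htop hpart
        rw [Finset.card_univ]
        omega)
    simp only [Finset.mem_union, Finset.mem_insert, Finset.mem_singleton, not_or] at hz
    obtain ⟨hzN, hzw, hzp⟩ := hz
    have hE : ∑ v ∈ N, x v + x w < totalSum p x + if p ∈ N then x p else 0 := by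
      have h1 : ∀ v, (if v ∈ N then x v else 0) + (if v = w then x v else 0) ≤
          (if v ≠ p then x v else 0) + if v = p then (if p ∈ N then x p else 0) else 0 := by
        intro v
        have := (hx v).le
        by_cases hvw : v = w
        · subst hvw
          simp [hw, hpw.symm]
        · by_cases hvp : v = p
          · subst hvp
            simp [hvw]
          · by_cases hvN : v ∈ N <;> simp [hvN, hvp, hvw, this]
      have h2 := Finset.sum_lt_sum (fun v (_ : v ∈ Finset.univ) => h1 v)
        ⟨z, Finset.mem_univ _, by simp [hzN, hzw, hzp, hx z]⟩
      simp only [Finset.sum_add_distrib] at h2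
      rw [← sum_eq_sum_ite_mem] at h2
      simpa [totalSum] using h2
    have hF : partSum c w x i + (if p ∈ N then x w else 0) + ∑ v ∈ N, x v + x w ≤
        totalSum p x + (if p ∈ N then x p else 0) + ∑ v ∈ N', x v + x p := by
      have h1 : ∀ v, (if v ≠ w ∧ (c v = none ∨ c v = some i) then x v else 0) +
          (if v = w then (if p ∈ N then x w else 0) else 0) + (if v ∈ N then x v else 0) +
          (if v = w then x v else 0) ≤ (if v ≠ p then x v else 0) +
          (if v = p then (if p ∈ N then x p else 0) else 0) + (if v ∈ N' then x v else 0) +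
          if v = p then x v else 0 := by
        intro v
        have := (hx v).le
        by_cases hvw : v = w
        · subst hvw
          simp [hw, hpw.symm, hwN', add_comm]
        · by_cases hvp : v = p
          · subst hvp
            simp [hvw, hp, hpN', add_comm]
          · by_cases hvN : v ∈ N
            · by_cases hci : c v = none ∨ c v = some i <;> simp [hN', hvw, hvp, hvN, hci]
            · by_cases hci : c v = none ∨ c v = some i <;> simp [hN', hvw, hvp, hvN, hci, this]
      have h2 := Finset.sum_le_sum fun v (_ : v ∈ Finset.univ) => h1 v
      simp only [Finset.sum_add_distrib] at h2
      rw [← sum_eq_sum_ite_mem, ← sum_eq_sum_ite_mem] at h2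
      simpa [totalSum, partSum] using h2
    refine ⟨c, p, N', ⟨htop, hpart, by simp [hp], hpN', fun v hv => ?_,
      ⟨q, by simp [hN', hqN, hq, hpq.symm], by rw [hp, hq]⟩, ?_⟩,
      spectralRadius_lt_of_adjForm_lt hx hxe ?_⟩
    · rw [hp]
      rcases (Finset.mem_filter.1 hv).2.2 with h1 | h1
      · exact Or.inl (h1.1 ▸ hcw)
      · exact h1.2
    · refine (Finset.card_le_card (t := N.image (Equiv.swap p w)) fun v hv => ?_).trans
        (Finset.card_image_le.trans hcard)
      obtain ⟨-, hvp, h1 | h1⟩ := Finset.mem_filter.1 hv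
      · exact Finset.mem_image.2 ⟨p, h1.2, by simp [h1.1]⟩
      · exact Finset.mem_image.2 ⟨v, h1.1,
          Equiv.swap_apply_of_ne_of_ne hvp fun h => hw (h ▸ h1.1)⟩
    · have h1 := adjForm_sub_adjForm (G := lowGraph c w N) (H := lowGraph c p N') hpw (by
          simp only [lowGraph, hwN', hpN']
          simp [hpw, hpw.symm, hw]) (fun u v h1 h2 h3 h4 => by
          simp [lowGraph, h1, h2, h3, h4]) x
      rw [nbrSum_lowGraph_some hw hpw hp, nbrSum_lowGraph_self hpN',
        nbrSum_lowGraph_none hpN' hpw.symm hcw, nbrSum_lowGraph_self hw] at h1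
      simp only [hwN'] at h1
      have h2 := mul_nonneg (hx p).le (sub_nonneg.2 hF)
      have h3 := mul_pos (sub_pos.2 hlt) (sub_pos.2 hE)
      linarith

lemma exists_isLowConfig_of_forall_top [Nontrivial ι] (hh : 1 ≤ h)
    (hconn : (lowGraph c w N).Connected)
    (htop : (Finset.univ.filter fun v => c v = none).card = κ)
    (hpart : ∀ i, h + 1 ≤ (Finset.univ.filter fun v => c v = some i).card)
    (hcw : c w = none) (hw : w ∉ N) (hcard : N.card ≤ δ) (hne : N.Nonempty)
    (hN : ∀ v ∈ N, c v = none) : ∃ (c' : V → Option ι) (w' : V) (N' : Finset V),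
      IsLowConfig h κ δ c' w' N' ∧
      (lowGraph c w N).spectralRadius < (lowGraph c' w' N').spectralRadius := by
  have hV : Nonempty V := ⟨w⟩
  obtain ⟨x, hx, hxe⟩ := exists_pos_eigenvector hconn
  obtain ⟨i, j, hij⟩ := exists_pair_ne ι
  obtain ⟨p, hp, hpw⟩ := exists_mem_part_ne hh hpart i w
  obtain ⟨q, hq, hqp⟩ := exists_mem_part_ne hh hpart i p
  obtain ⟨z, hz, hzw⟩ := exists_mem_part_ne hh hpart j w
  obtain ⟨y, hy, hyz⟩ := exists_mem_part_ne hh hpart j z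
  obtain ⟨t, htN⟩ := hne
  have ht := hN t htN
  have hout : ∀ {v k}, c v = some k → v ≠ w ∧ v ∉ N := by
    intro v k hv
    refine ⟨?_, fun h => by simp [hN v h] at hv⟩
    rintro rfl
    simp [hv] at hcw
  have htw : t ≠ w := fun h => hw (h ▸ htN)
  have hrow : ∀ {v k}, c v = some k →
      partSum c w x k - x v = (lowGraph c w N).spectralRadius * x v := by
    intro v k hv
    rw [← hxe, nbrSum_lowGraph_some hw (hout hv).1 hv, if_neg (hout hv).2, add_zero]
  have hsum : ∀ {u v k}, c u = some k → c v = some k → u ≠ v →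
      ∑ a ∈ N, x a + x u + x v ≤ partSum c w x k := by
    intro u v k hu hv huv
    have h1 : ∀ a, (if a ∈ N then x a else 0) + (if a = u then x a else 0) +
        (if a = v then x a else 0) ≤
        if a ≠ w ∧ (c a = none ∨ c a = some k) then x a else 0 := by
      intro a
      have := (hx a).le
      by_cases hau : a = u
      · subst hau
        simp [(hout hu).1, (hout hu).2, huv, hu]
      by_cases hav : a = v
      · subst hav
        simp [(hout hv).1, (hout hv).2, hau, hv]
      by_cases haN : a ∈ N
      · have : a ≠ w := fun h => hw (h ▸ haN)
        simp [hau, hav, haN, this, hN a haN]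
      · simp only [hau, hav, haN, if_false]
        split_ifs <;> simp [this]
    have h2 := Finset.sum_le_sum fun a (_ : a ∈ Finset.univ) => h1 a
    simp only [Finset.sum_add_distrib] at h2
    rw [← sum_eq_sum_ite_mem] at h2
    simpa [partSum] using h2
  have htot : partSum c w x i + x z ≤ totalSum w x := by
    have h1 : ∀ v, (if v ≠ w ∧ (c v = none ∨ c v = some i) then x v else 0) +
        (if v = z then x v else 0) ≤ if v ≠ w then x v else 0 := by
      intro v
      have := (hx v).le
      by_cases h1 : v = z
      · subst h1
        simp [hz, hzw, hij.symm]
      · simp only [h1, if_false]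
        split_ifs <;> simp_all
    have h2 := Finset.sum_le_sum fun v (_ : v ∈ Finset.univ) => h1 v
    simp only [Finset.sum_add_distrib] at h2
    simpa [partSum, totalSum] using h2
  have et := hxe t
  rw [nbrSum_lowGraph_none hw htw ht, if_pos htN] at et
  have ew := hxe w
  rw [nbrSum_lowGraph_self hw] at ew
  have ep := hrow hp
  have eq := hrow hq
  have ez := hrow hz
  have sp := hsum hp hq hqp.symm
  have sz := hsum hz hy hyz.symm
  set ρ := (lowGraph c w N).spectralRadius
  have hxp := hx p
  have hxw := hx w
  have hxq := hx q
  have hxz := hx z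
  have hxy := hx y
  have hxt := hx t
  have hNpos : x t ≤ ∑ v ∈ N, x v := Finset.single_le_sum (fun v _ => (hx v).le) htN
  have hρ0 : 0 < ρ := by
    by_contra! h0
    nlinarith
  have hpq : x p = x q := by
    have : (ρ + 1) * (x p - x q) = 0 := by linarith
    rcases mul_eq_zero.1 this with h0 | h0 <;> linarith
  have hρ1 : 1 < ρ := by
    by_contra! h0
    nlinarith
  have hwp : x w ≤ x p := by
    refine le_of_mul_le_mul_left ?_ hρ0
    linarith
  have hwz : x w ≤ x z := by
    refine le_of_mul_le_mul_left ?_ hρ0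
    linarith
  set g := totalSum w x - partSum c w x i with hg
  have hg0 : 0 < g := by linarith
  have hgain : 0 < x p * g - x w * (x t - x q) := by
    have h1 : (ρ + 1) * (x t - x q) = g + x w := by linarith
    have h2 : (ρ + 1) * (x p * g - x w * (x t - x q)) =
        (ρ + 1) * (x p * g) - x w * (g + x w) := by
      rw [← h1]
      ring
    have h3 : x w * (g + x w) ≤ x p * (g + g) := by
      gcongr
      linarith
    have h4 : 0 < x p * g := by positivity
    refine pos_of_mul_pos_right (a := ρ + 1) ?_ (by linarith)
    rw [h2]
    nlinarith
  set c' := c ∘ Equiv.swap p w with hc'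
  have hcp : c' p = none := by simp [hc', hcw]
  have hcw' : c' w = some i := by simp [hc', hp]
  have hcv : ∀ v, v ≠ p → v ≠ w → c' v = c v := by
    intro v h1 h2
    simp [hc', Equiv.swap_apply_of_ne_of_ne h1 h2]
  have hqw := (hout hq).1
  have hqN := (hout hq).2
  have hpN := (hout hp).2
  have hwN' : w ∉ insert q (N.erase t) := by simp [hqw.symm, hw]
  have hpN' : p ∉ insert q (N.erase t) := by simp [hqp.symm, hpN]
  have hsum' : ∑ v ∈ insert q (N.erase t), x v = ∑ v ∈ N, x v - x t + x q := by
    rw [Finset.sum_insert (by simp [hqN]), ← Finset.add_sum_erase _ _ htN]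
    ring
  refine ⟨c', w, insert q (N.erase t), ⟨?_, fun k => ?_, by simp [hcw'], hwN', fun v hv => ?_,
    ⟨q, by simp, by rw [hcv q hqp hqw, hcw', hq]⟩, ?_⟩, spectralRadius_lt_of_adjForm_lt hx hxe ?_⟩
  · rw [card_filter_comp_swap, htop]
  · rw [card_filter_comp_swap]
    exact hpart k
  · rcases Finset.mem_insert.1 hv with rfl | hv
    · exact Or.inr (by rw [hcv v hqp hqw, hcw', hq])
    · have h2 := Finset.mem_of_mem_erase hv
      exact Or.inl (by
        rw [hcv v (fun h => hpN (h ▸ h2)) fun h => hw (h ▸ h2), hN v h2])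
  · rw [Finset.card_insert_of_notMem (by simp [hqN]), Finset.card_erase_add_one htN]
    exact hcard
  · have h1 := adjForm_sub_adjForm (G := lowGraph c w N)
      (H := lowGraph c' w (insert q (N.erase t))) hpw (by
        simp only [lowGraph, hpN, hpN']
        simp [hpw]) (fun u v h1 h2 h3 h4 => by
        simp only [lowGraph, hcv u h1 h2, hcv v h3 h4, h2, h4]
        simp) x
    rw [nbrSum_lowGraph_some hw hpw hp, nbrSum_lowGraph_none hwN' hpw hcp, if_neg hpN,
      if_neg hpN', nbrSum_lowGraph_self hw, nbrSum_lowGraph_self hwN', hsum'] at h1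
    rw [hg] at hgain
    linarith

lemma exists_isLowConfig_of_color_eq_none [Nontrivial ι] (hh : 1 ≤ h) (hδκ : δ ≤ κ)
    (hconn : (lowGraph c w N).Connected)
    (htop : (Finset.univ.filter fun v => c v = none).card = κ)
    (hpart : ∀ i, h + 1 ≤ (Finset.univ.filter fun v => c v = some i).card)
    (hcw : c w = none) (hw : w ∉ N) (hcard : N.card ≤ δ) (hne : N.Nonempty) :
    ∃ (c' : V → Option ι) (w' : V) (N' : Finset V), IsLowConfig h κ δ c' w' N' ∧
      (lowGraph c w N).spectralRadius < (lowGraph c' w' N').spectralRadius := by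
  by_cases hN : ∀ v ∈ N, c v = none
  · exact exists_isLowConfig_of_forall_top hh hconn htop hpart hcw hw hcard hne hN
  · push Not at hN
    obtain ⟨q, hqN, hq⟩ := hN
    obtain ⟨i, hi⟩ := Option.ne_none_iff_exists'.1 hq
    exact exists_isLowConfig_of_meet hh hδκ hconn htop hpart hcw hw hcard hqN hi

/-- The number of vertices of colour `o`. -/
noncomputable def fiberCard (c : V → Option ι) (o : Option ι) : ℕ :=
  (Finset.univ.filter fun v => c v = o).card

lemma IsLowConfig.shape_of_maximal [Finite ι] [Nontrivial ι] (hv : IsLowConfig h κ δ c w N)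
    (hκ : 1 ≤ κ) (hδκ : δ ≤ κ) (hh : 1 ≤ h)
    (hmax : ∀ (c' : V → Option ι) (w' : V) (N' : Finset V), IsLowConfig h κ δ c' w' N' →
      (lowGraph c' w' N').spectralRadius ≤ (lowGraph c w N).spectralRadius) :
    N.card = δ ∧ (∀ b ∈ N, ∀ b' ∈ N, c b = c w → c b' = c w → b = b') ∧
      ∃ j, c w ≠ some j ∧ ∀ i ≠ j, fiberCard c (some i) = h + 1 := by
  have hunique : ∀ b ∈ N, ∀ b' ∈ N, c b = c w → c b' = c w → b = b' := by
    intro b hb b' hb' hbw hbw'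
    by_contra hne
    obtain ⟨c', N', hv', hlt⟩ := hv.exists_lt_of_two_mem hκ hδκ hb hb' hne hbw hbw' hh
    exact hlt.not_ge (hmax _ _ _ hv')
  refine ⟨le_antisymm hv.card_le ?_, hunique, ?_⟩
  · by_contra! hlt
    obtain ⟨N', hv', hlt⟩ := hv.exists_lt_of_card_lt hκ hδκ hlt
    exact hlt.not_ge (hmax _ _ _ hv')
  · obtain ⟨x, hx, hxe⟩ := exists_pos_eigenvector (hv.connected hκ)
    have hsmall : ∀ i j, i ≠ j → partSum c w x i ≤ partSum c w x j →
        (Finset.univ.filter fun v => c v = some i).card = h + 1 := by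
      intro i j hij hle
      by_contra hne
      obtain ⟨c', hv', hlt⟩ := hv.exists_lt_of_partSum_le hh hunique hx hxe hij hle
        (by have := hv.part i; omega)
      exact hlt.not_ge (hmax _ _ _ hv')
    obtain ⟨j, hj⟩ := Finite.exists_max (partSum c w x)
    by_cases hjw : c w = some j
    · obtain ⟨k, hk⟩ := exists_ne j
      refine ⟨k, fun h => hk (Option.some_injective _ (h.symm.trans hjw)), fun i _ => ?_⟩
      by_cases hij : i = j
      · subst hij
        refine hsmall i k hk.symm (le_of_not_gt fun hlt => ?_)
        obtain ⟨c', N', hv', hlt⟩ := hv.exists_lt_of_partSum_lt hδκ hh hunique hx hxe hjw hlt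
        exact hlt.not_ge (hmax _ _ _ hv')
      · exact hsmall i j hij (hj i)
    · exact ⟨j, hjw, fun i hi => hsmall i j hi (hj i)⟩

lemma IsLowConfig.card_filter_color (hv : IsLowConfig h κ δ c w N)
    (hb : ∀ b ∈ N, ∀ b' ∈ N, c b = c w → c b' = c w → b = b') (o : Option ι) :
    (N.filter fun v => c v = o).card = if o = none then N.card - 1 else if o = c w then 1 else 0 := by
  have h1 : (N.filter fun v => c v = c w).card = 1 := by
    obtain ⟨b, hbN, hbw⟩ := hv.meet
    refine Finset.card_eq_one.2 ⟨b, ?_⟩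
    ext v
    simp only [Finset.mem_filter, Finset.mem_singleton]
    constructor
    · exact fun h => hb v h.1 b hbN h.2 hbw
    · rintro rfl
      exact ⟨hbN, hbw⟩
  split_ifs with h2 h3
  · subst h2
    have h4 := Finset.card_filter_add_card_filter_not (s := N) fun v => c v = none
    have h5 : (N.filter fun v => ¬ c v = none) = N.filter fun v => c v = c w := by
      refine Finset.filter_congr fun v hvN => ?_
      rcases hv.sub v hvN with h5 | h5
      · simp [h5, hv.color.symm]
      · simp [h5, hv.color]
    rw [h5, h1] at h4
    omega
  · rw [h3, h1]
  · refine Finset.card_eq_zero.2 (Finset.filter_eq_empty_iff.2 fun v hvN h4 => ?_)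
    rcases hv.sub v hvN with h5 | h5
    exacts [h2 (h4.symm.trans h5), h3 (h4.symm.trans h5)]

lemma card_filter_label (hw : w ∉ N) (o : Option ι) (m s : Prop) :
    (Finset.univ.filter fun v => (c v, v ∈ N, v = w) = (o, m, s)).card =
      if s then (if m then 0 else if o = c w then 1 else 0)
      else if m then (N.filter fun v => c v = o).card
      else (Finset.univ.filter fun v => c v = o).card - (N.filter fun v => c v = o).card -
        if o = c w then 1 else 0 := by
  by_cases hs : s
  · by_cases hm : m
    · simp only [hs, hm, if_true, Finset.card_eq_zero, Finset.filter_eq_empty_iff]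
      intro v _ h
      simp only [Prod.mk.injEq, eq_iff_iff, iff_true] at h
      exact hw (h.2.2 ▸ h.2.1)
    · by_cases ho : o = c w
      · simp only [hs, hm, ho, if_true, if_false, Finset.card_eq_one]
        refine ⟨w, ?_⟩
        ext v
        simp only [Prod.mk.injEq, eq_iff_iff, iff_true, iff_false, Finset.mem_filter,
          Finset.mem_univ, true_and, Finset.mem_singleton]
        constructor
        · exact fun h => h.2.2
        · rintro rfl
          exact ⟨rfl, hw, rfl⟩
      · simp only [hs, hm, ho, if_true, if_false, Finset.card_eq_zero,
          Finset.filter_eq_empty_iff]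
        intro v _ h
        simp only [Prod.mk.injEq, eq_iff_iff, iff_true] at h
        exact ho (h.2.2 ▸ h.1.symm)
  · by_cases hm : m
    · simp only [hs, hm, if_true, if_false]
      congr 1
      ext v
      simp only [Prod.mk.injEq, eq_iff_iff, iff_true, iff_false, Finset.mem_filter,
        Finset.mem_univ, true_and]
      constructor
      · exact fun h => ⟨h.2.1, h.1⟩
      · exact fun h => ⟨h.2, h.1, fun hvw => hw (hvw ▸ h.1)⟩
    · simp only [hs, hm, if_false]
      have h1 : (Finset.univ.filter fun v => (c v, v ∈ N, v = w) = (o, False, False)) =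
          (((Finset.univ.filter fun v => c v = o) \ N.filter fun v => c v = o) \
            if o = c w then {w} else ∅) := by
        ext v
        by_cases ho : o = c w
        · simp only [Prod.mk.injEq, eq_iff_iff, iff_false, Finset.mem_filter, Finset.mem_univ,
            true_and, Finset.mem_sdiff, ho, if_true, Finset.mem_singleton]
          tauto
        · simp only [Prod.mk.injEq, eq_iff_iff, iff_false, Finset.mem_filter, Finset.mem_univ,
            true_and, Finset.mem_sdiff, ho, if_false, Finset.notMem_empty, not_false_eq_true,
            and_true]
          constructor
          · tauto
          · rintro ⟨h1, h2⟩
            refine ⟨h1, fun h3 => h2 ⟨h3, h1⟩, ?_⟩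
            rintro rfl
            exact ho h1.symm
      rw [h1, Finset.card_sdiff_of_subset, Finset.card_sdiff_of_subset]
      · congr 1
        split_ifs <;> simp
      · exact Finset.filter_subset_filter _ (Finset.subset_univ _)
      · split_ifs with ho
        · simp [ho, hw]
        · simp

/-- Configurations with the same statistics have isomorphic graphs. -/
lemma IsLowConfig.nonempty_iso {V' : Type*} [Fintype V'] [Fintype ι] {c' : V' → Option ι}
    {w' : V'} {N' : Finset V'} (hv : IsLowConfig h κ δ c w N) (hv' : IsLowConfig h κ δ c' w' N')
    (hb : ∀ b ∈ N, ∀ b' ∈ N, c b = c w → c b' = c w → b = b')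
    (hb' : ∀ b ∈ N', ∀ b' ∈ N', c' b = c' w' → c' b' = c' w' → b = b')
    (hN : N.card = N'.card) (hw : c w = c' w') (hV : Fintype.card V = Fintype.card V') (j : ι)
    (hj : ∀ i ≠ j, fiberCard c (some i) = fiberCard c' (some i)) :
    Nonempty (lowGraph c w N ≃g lowGraph c' w' N') := by
  have hne : ∀ o, o ≠ some j → (Finset.univ.filter fun v => c v = o).card =
      (Finset.univ.filter fun v => c' v = o).card := by
    rintro (_ | i) hi
    · rw [hv.top, hv'.top]
    · exact hj i fun h => hi (h ▸ rfl)
  have hall : ∀ o, (Finset.univ.filter fun v => c v = o).card =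
      (Finset.univ.filter fun v => c' v = o).card := by
    intro o
    by_cases ho : o = some j
    · have h1 := Finset.card_eq_sum_card_fiberwise (f := c) (s := Finset.univ) (t := Finset.univ)
        (by simp)
      have h2 := Finset.card_eq_sum_card_fiberwise (f := c') (s := Finset.univ)
        (t := Finset.univ) (by simp)
      rw [Finset.card_univ, ← Finset.add_sum_erase _ _ (Finset.mem_univ (some j))] at h1 h2
      rw [Finset.sum_congr rfl fun o ho => hne o (Finset.ne_of_mem_erase ho)] at h1
      subst ho
      omega
    · exact hne o ho
  have hfib : ∀ l, Nonempty ({v // (c v, v ∈ N, v = w) = l} ≃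
      {v // (c' v, v ∈ N', v = w') = l}) := by
    rintro ⟨o, m, s⟩
    refine ⟨Fintype.equivOfCardEq ?_⟩
    rw [Fintype.card_subtype, Fintype.card_subtype, card_filter_label hv.notMem,
      card_filter_label hv'.notMem, hall, hv.card_filter_color hb, hv'.card_filter_color hb', hN,
      hw]
  let e := Equiv.ofFiberEquiv (f := fun v => (c v, v ∈ N, v = w))
    (g := fun v => (c' v, v ∈ N', v = w')) fun l => (hfib l).some
  have he : ∀ v, (c' (e v), e v ∈ N', e v = w') = (c v, v ∈ N, v = w) := fun v =>
    Equiv.ofFiberEquiv_map (f := fun v => (c v, v ∈ N, v = w))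
      (g := fun v => (c' v, v ∈ N', v = w')) (fun l => (hfib l).some) v
  simp only [Prod.mk.injEq, eq_iff_iff] at he
  refine ⟨⟨e, fun {u v} => ?_⟩⟩
  simp only [lowGraph, he, ne_eq, e.injective.eq_iff]

section Star

variable {n r : ℕ}

/-- The colouring of the vertices of `GStarLow`. -/
def starColor (i j : Fin r) (e : Fin (r - 2) → Fin r) : GVert n r h κ → Option (Fin r) :=
  Sum.elim (fun _ => none) (Sum.elim (fun _ => some j)
    (Sum.elim (fun p => some (e p.1)) (Sum.elim (fun _ => some i) fun _ => some i)))

/-- The neighbours of the low vertex of `GStarLow`. -/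
noncomputable def starNbr (n r h κ δ : ℕ) : Finset (GVert n r h κ) :=
  (Finset.univ.filter fun a : Fin κ => (a : ℕ) < δ - 1).disjSum (Finset.disjSum ∅
    (Finset.disjSum ∅ ((Finset.univ.filter fun a : Fin h => (a : ℕ) = 0).disjSum ∅)))

/-- The low vertex of `GStarLow`. -/
def starLow (n r h κ : ℕ) : GVert n r h κ := .inr (.inr (.inr (.inr ())))

lemma GStarLow_eq_lowGraph {i j : Fin r} (hij : i ≠ j) {e : Fin (r - 2) → Fin r}
    (he : Function.Injective e) (hei : ∀ a, e a ≠ i) (hej : ∀ a, e a ≠ j) :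
    GStarLow n r h κ δ =
      lowGraph (starColor i j e) (starLow n r h κ) (starNbr n r h κ δ) := by
  ext u v
  rcases u with u | u | u | u | u <;> rcases v with v | v | v | v | v <;>
    simp [GStarLow, lowGraph, starColor, starLow, starNbr, he.eq_iff, hei, hej, hij, hij.symm,
      (hei _).symm, (hej _).symm]
  exact fun _ h => h.symm

lemma card_starNbr (hh : 1 ≤ h) (hδ : 1 ≤ δ) (hδκ : δ ≤ κ) : (starNbr n r h κ δ).card = δ := by
  have h1 : (Finset.univ.filter fun a : Fin κ => (a : ℕ) < δ - 1).card = δ - 1 := by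
    rw [Fin.card_filter_val_lt]
    omega
  have h2 : (Finset.univ.filter fun a : Fin h => (a : ℕ) = 0).card = 1 := by
    refine Finset.card_eq_one.2 ⟨⟨0, hh⟩, ?_⟩
    ext a
    simp [Fin.ext_iff]
  simp only [starNbr, Finset.card_disjSum, h1, h2, Finset.card_empty]
  omega

lemma card_GVert (hr : 2 ≤ r) (hn : κ + r * (h + 1) ≤ n) :
    Fintype.card (GVert n r h κ) = n := by
  obtain ⟨s, rfl⟩ := Nat.exists_eq_add_of_le' hr
  have h1 : (s + 2) * (h + 1) = s * (h + 1) + 2 * (h + 1) := by ring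
  have h2 : (s + 2 - 1) * (h + 1) = s * (h + 1) + (h + 1) := by
    rw [show s + 2 - 1 = s + 1 by omega]
    ring
  simp only [GVert, Fintype.card_sum, Fintype.card_prod, Fintype.card_fin, Fintype.card_unit, h2,
    Nat.add_sub_cancel]
  omega

lemma fiberCard_starColor {i j : Fin r} (e : Fin (r - 2) ≃ {k : Fin r // k ≠ i ∧ k ≠ j})
    (k : Fin r) (hk : k ≠ j) : fiberCard (starColor (n := n) (h := h) (κ := κ) i j
      fun a => (e a : Fin r)) (some k) = h + 1 := by
  rw [fiberCard, Finset.card_filter]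
  simp only [starColor, Fintype.sum_sum_type, Fintype.sum_prod_type, Sum.elim_inl, Sum.elim_inr]
  by_cases hki : i = k
  · subst hki
    simp [hk.symm, (e _).2.1]
  · have h1 : ∀ a, (e a : Fin r) = k ↔ a = e.symm ⟨k, Ne.symm hki, hk⟩ := by
      intro a
      rw [Equiv.eq_symm_apply, Subtype.ext_iff]
    simp [hk.symm, hki, h1]

lemma isLowConfig_star (hr : 2 ≤ r) (hh : 1 ≤ h) (hδ : 1 ≤ δ) (hδκ : δ ≤ κ)
    (hn : κ + r * (h + 1) ≤ n) {i j : Fin r} (hij : i ≠ j)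
    (e : Fin (r - 2) ≃ {k : Fin r // k ≠ i ∧ k ≠ j}) :
    IsLowConfig h κ δ (starColor i j fun a => (e a : Fin r)) (starLow n r h κ)
      (starNbr n r h κ δ) := by
  refine ⟨?_, fun k => ?_, by simp [starColor, starLow], by simp [starLow, starNbr], ?_,
    ⟨.inr (.inr (.inr (.inl ⟨0, hh⟩))), by simp [starNbr], by simp [starColor, starLow]⟩,
    (card_starNbr hh hδ hδκ).le⟩
  · rw [Finset.card_filter]
    simp only [starColor, Fintype.sum_sum_type, Sum.elim_inl, Sum.elim_inr]
    simp
  · by_cases hk : k = j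
    · subst hk
      rw [Finset.card_filter]
      simp only [starColor, Fintype.sum_sum_type, Fintype.sum_prod_type, Sum.elim_inl,
        Sum.elim_inr]
      have he : ∀ a, (e a : Fin r) ≠ k := fun a => (e a).2.2
      simp only [Option.some.injEq, he, hij, reduceCtorEq, if_true, if_false]
      simp only [Finset.sum_const_zero, Finset.sum_const, Finset.card_univ, Fintype.card_fin,
        smul_eq_mul, mul_one, zero_add, add_zero]
      obtain ⟨s, rfl⟩ := Nat.exists_eq_add_of_le' hr
      have h1 : (s + 2) * (h + 1) = s * (h + 1) + 2 * (h + 1) := by ring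
      have h2 : (s + 2 - 1) * (h + 1) = s * (h + 1) + (h + 1) := by
        rw [show s + 2 - 1 = s + 1 by omega]
        ring
      rw [h2]
      omega
    · exact (fiberCard_starColor e k hk).ge
  · rintro (v | v | v | v | v) hv <;> simp_all [starNbr, starColor, starLow]

lemma IsLowConfig.nonempty_iso_GStarLow {c : V → Option (Fin r)} (hr : 2 ≤ r) (hh : 1 ≤ h)
    (hδ : 1 ≤ δ) (hδκ : δ ≤ κ) (hn : κ + r * (h + 1) ≤ n) (hV : Fintype.card V = n)
    (hv : IsLowConfig h κ δ c w N)
    (hb : ∀ b ∈ N, ∀ b' ∈ N, c b = c w → c b' = c w → b = b') (hN : N.card = δ) {j : Fin r}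
    (hjw : c w ≠ some j)
    (hj : ∀ i ≠ j, fiberCard c (some i) = h + 1) :
    Nonempty (lowGraph c w N ≃g GStarLow n r h κ δ) := by
  obtain ⟨i, hi⟩ := Option.ne_none_iff_exists'.1 hv.color
  have hij : i ≠ j := by
    rintro rfl
    exact hjw hi
  have hcard : Fintype.card (Fin (r - 2)) = Fintype.card {k : Fin r // k ≠ i ∧ k ≠ j} := by
    have h1 : (Finset.univ.filter fun k : Fin r => k ≠ i ∧ k ≠ j) = {i, j}ᶜ := by
      ext k
      simp
    rw [Fintype.card_subtype, h1, Finset.card_compl, Finset.card_pair hij]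
    simp
  let e := Fintype.equivOfCardEq hcard
  rw [GStarLow_eq_lowGraph hij (e := fun a => (e a : Fin r))
    (fun a b hab => e.injective (Subtype.ext hab)) (fun a => (e a).2.1) fun a => (e a).2.2]
  refine hv.nonempty_iso (isLowConfig_star hr hh hδ hδκ hn hij e) hb ?_
    (hN.trans (card_starNbr hh hδ hδκ).symm) (by simp [hi, starColor, starLow])
    (hV.trans (card_GVert hr hn).symm) j fun k hk => by
      rw [hj k hk, fiberCard_starColor e k hk]
  rintro (a | a | a | a | a) ha (b | b | b | b | b) hb <;>
    simp_all [starNbr, starColor, starLow]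
  exact Fin.ext (ha.trans hb.symm)

lemma IsLowConfig.spectralRadius_le {c : V → Option (Fin r)} (hr : 2 ≤ r) (hh : 1 ≤ h)
    (hδ : 1 ≤ δ) (hδκ : δ ≤ κ) (hn : κ + r * (h + 1) ≤ n) (hV : Fintype.card V = n)
    (hv : IsLowConfig h κ δ c w N) :
    (lowGraph c w N).spectralRadius ≤ (GStarLow n r h κ δ).spectralRadius ∧
      ((lowGraph c w N).spectralRadius = (GStarLow n r h κ δ).spectralRadius →
        Nonempty (lowGraph c w N ≃g GStarLow n r h κ δ)) := by
  have hne : Nonempty V := ⟨w⟩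
  have hι : Nontrivial (Fin r) := Fin.nontrivial_iff_two_le.2 hr
  have hκ : 1 ≤ κ := hδ.trans hδκ
  have hiso : ∀ (c' : V → Option (Fin r)) (w' : V) (N' : Finset V), IsLowConfig h κ δ c' w' N' →
      (∀ (c'' : V → Option (Fin r)) (w'' : V) (N'' : Finset V), IsLowConfig h κ δ c'' w'' N'' →
        (lowGraph c'' w'' N'').spectralRadius ≤ (lowGraph c' w' N').spectralRadius) →
      Nonempty (lowGraph c' w' N' ≃g GStarLow n r h κ δ) := by
    intro c' w' N' hv' hmax
    obtain ⟨h1, h2, j, h3, h4⟩ := hv'.shape_of_maximal hκ hδκ hh hmax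
    exact hv'.nonempty_iso_GStarLow hr hh hδ hδκ hn hV h2 h1 h3 h4
  obtain ⟨⟨c', w', N'⟩, hv', hmax⟩ := Set.exists_max_image
    {t : (V → Option (Fin r)) × V × Finset V | IsLowConfig h κ δ t.1 t.2.1 t.2.2}
    (fun t => (lowGraph t.1 t.2.1 t.2.2).spectralRadius) (Set.toFinite _) ⟨(c, w, N), hv⟩
  obtain ⟨e⟩ := hiso c' w' N' hv' fun c'' w'' N'' hv'' => hmax (c'', w'', N'') hv''
  rw [← spectralRadius_eq_of_iso e]
  refine ⟨hmax (c, w, N) hv, fun heq => hiso c w N hv fun c'' w'' N'' hv'' => ?_⟩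
  rw [heq]
  exact hmax (c'', w'', N'') hv''

end Star

/-- The components left by a good vertex cut give a colouring such that `G` is contained in the
graph of the corresponding configuration. -/
lemma exists_color_of_goodVertexCut {G : SimpleGraph V} {r : ℕ} (hr : 2 ≤ r) (hh : 1 ≤ h)
    {S : Finset V} (hS : GoodVertexCut G r h S) (w : V) :
    ∃ c : V → Option (Fin r), G ≤ lowGraph c w (G.neighborFinset w) ∧
      fiberCard c none = S.card ∧ (∀ i, h + 1 ≤ fiberCard c (some i)) ∧
      (c w ≠ none → (∀ v ∈ G.neighborFinset w, c v = none ∨ c v = c w) ∧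
        ∃ v ∈ G.neighborFinset w, c v = c w) := by
  obtain ⟨hcomp, hsize⟩ := hS
  set H := G.induce ((S : Set V)ᶜ)
  have : Nonempty (Fin r) := ⟨⟨0, by omega⟩⟩
  have : Fintype H.ConnectedComponent := Fintype.ofFinite _
  obtain ⟨g⟩ := Function.Embedding.nonempty_of_card_le (α := Fin r) (β := H.ConnectedComponent)
    (by rwa [Fintype.card_fin, ← Nat.card_eq_fintype_card])
  obtain ⟨f, hf⟩ : ∃ f : H.ConnectedComponent → Fin r, Function.Surjective f :=
    ⟨Function.invFun g, Function.invFun_surjective g.injective⟩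
  have hmem : ∀ {v}, v ∉ S → v ∈ ((S : Set V)ᶜ) := fun hv => by simpa using hv
  obtain ⟨c, hcS, hcn⟩ : ∃ c : V → Option (Fin r), (∀ v ∈ S, c v = none) ∧
      ∀ v (hv : v ∉ S), c v = some (f (H.connectedComponentMk ⟨v, hmem hv⟩)) :=
    ⟨fun v => if hv : v ∈ S then none else some (f (H.connectedComponentMk ⟨v, hmem hv⟩)),
      fun v hv => by simp [hv], fun v hv => by simp [hv]⟩
  have hadj : ∀ {u v}, G.Adj u v → c u = none ∨ c v = none ∨ c u = c v := by
    intro u v huv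
    by_cases hu : u ∈ S
    · exact Or.inl (hcS u hu)
    by_cases hv : v ∈ S
    · exact Or.inr (Or.inl (hcS v hv))
    refine Or.inr (Or.inr ?_)
    rw [hcn u hu, hcn v hv]
    have : H.Adj ⟨u, hmem hu⟩ ⟨v, hmem hv⟩ := huv
    rw [SimpleGraph.ConnectedComponent.eq.2 this.reachable]
  refine ⟨c, fun u v huv => ⟨huv.ne, ?_⟩, ?_, fun i => ?_, fun hcw => ⟨fun v hv => ?_, ?_⟩⟩
  · by_cases hu : u = w
    · subst hu
      exact Or.inl ⟨rfl, by simpa using huv⟩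
    by_cases hv : v = w
    · subst hv
      exact Or.inr (Or.inl ⟨rfl, by simpa using huv.symm⟩)
    exact Or.inr (Or.inr ⟨hu, hv, hadj huv⟩)
  · rw [fiberCard]
    congr 1
    ext v
    by_cases hv : v ∈ S
    · simp [hv, hcS v hv]
    · simp [hv, hcn v hv]
  · obtain ⟨K, hK⟩ := hf i
    refine (hsize K).trans ?_
    rw [fiberCard, ← Fintype.card_subtype, ← Nat.card_eq_fintype_card]
    refine Nat.card_le_card_of_injective (fun v : K.supp => ⟨v.1.1, ?_⟩) fun a b hab =>
      Subtype.ext (Subtype.ext (by simpa using hab))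
    have h1 : v.1.1 ∉ S := fun h => v.1.2 (Finset.mem_coe.2 h)
    rw [hcn _ h1, ← hK]
    congr 2
    exact v.2
  · rcases hadj ((SimpleGraph.mem_neighborFinset _ _ _).1 hv) with h1 | h1 | h1
    exacts [absurd h1 hcw, Or.inl h1, Or.inr h1.symm]
  · have hwS : w ∉ S := fun h => hcw (hcS w h)
    set a : ((S : Set V)ᶜ : Set V) := ⟨w, hmem hwS⟩
    have h1 := hsize (H.connectedComponentMk a)
    have h2 : Nontrivial (H.connectedComponentMk a).supp :=
      Finite.one_lt_card_iff_nontrivial.1 (by omega)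
    obtain ⟨⟨b, hb⟩, hba⟩ := exists_ne
      (⟨a, rfl⟩ : (H.connectedComponentMk a).supp)
    have h3 : H.Reachable a b := (SimpleGraph.ConnectedComponent.eq.1 hb).symm
    obtain ⟨p⟩ := h3
    cases p with
    | nil => exact absurd rfl hba
    | @cons _ y _ hay p =>
      have hy : y.1 ∉ S := fun h => y.2 (Finset.mem_coe.2 h)
      refine ⟨y.1, (SimpleGraph.mem_neighborFinset _ _ _).2 hay, ?_⟩
      rw [hcn y.1 hy, hcn w hwS]
      congr 2
      exact SimpleGraph.ConnectedComponent.eq.2 hay.reachable.symm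

lemma spectralRadius_le_GStarLow {G : SimpleGraph V} {n r : ℕ} (hr : 2 ≤ r) (hh : 1 ≤ h)
    (hδ : 1 ≤ δ) (hδκ : δ ≤ κ) (hn : κ + r * (h + 1) ≤ n) (hV : Fintype.card V = n)
    (hconn : G.Connected) (hw : (G.neighborFinset w).card = δ) {S : Finset V} (hSκ : S.card = κ)
    (hS : GoodVertexCut G r h S) :
    G.spectralRadius ≤ (GStarLow n r h κ δ).spectralRadius ∧
      (G.spectralRadius = (GStarLow n r h κ δ).spectralRadius →
        Nonempty (G ≃g GStarLow n r h κ δ)) := by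
  have hι : Nontrivial (Fin r) := Fin.nontrivial_iff_two_le.2 hr
  obtain ⟨c, hle, htop, hpart, hcw⟩ := exists_color_of_goodVertexCut hr hh hS w
  have hwN : w ∉ G.neighborFinset w := by simp
  have h1 := spectralRadius_le_of_le hconn hle
  by_cases h2 : c w = none
  · obtain ⟨c', w', N', hv, hlt⟩ := exists_isLowConfig_of_color_eq_none hh hδκ (hconn.mono hle)
      (htop.trans hSκ) hpart h2 hwN hw.le (Finset.card_pos.1 (by omega))
    have h3 := h1.trans_lt (hlt.trans_le (hv.spectralRadius_le hr hh hδ hδκ hn hV).1)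
    exact ⟨h3.le, fun h => absurd h h3.ne⟩
  · obtain ⟨hsub, hmeet⟩ := hcw h2
    obtain ⟨h3, h4⟩ := IsLowConfig.spectralRadius_le (c := c) hr hh hδ hδκ hn hV
      ⟨htop.trans hSκ, hpart, h2, hwN, hsub, hmeet, hw.le⟩
    refine ⟨h1.trans h3, fun heq => ?_⟩
    rcases hle.eq_or_lt with h5 | h5
    · rw [← h5] at h4
      exact h4 heq
    · exact absurd heq ((spectralRadius_lt_of_lt hconn h5).trans_le h3).ne

end LowGraph

theorem spectral_extremal_extraConnectivity_low {V : Type*} [Fintype V] [DecidableEq V]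
    (G : SimpleGraph V) [DecidableRel G.Adj] (n r h κ δ : ℕ)
    (hr : 2 ≤ r) (hh : 1 ≤ h) (hκ : 1 ≤ κ) (hδ : 1 ≤ δ) (hn : 1 ≤ n)
    (hδκ : δ ≤ κ) (hnbig : κ + r * (h + 1) ≤ n)
    (hcard : Fintype.card V = n) (hconn : G.Connected)
    (hmin : G.minDegree = δ) (hκG : HasExtraConnectivity G r h κ) :
    G.spectralRadius ≤ (GStarLow n r h κ δ).spectralRadius ∧
      (G.spectralRadius = (GStarLow n r h κ δ).spectralRadius ↔
        Nonempty (G ≃g GStarLow n r h κ δ)) := by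
  have := hconn.nonempty
  obtain ⟨S, hSκ, hS⟩ := hκG.1
  obtain ⟨w, hw⟩ := G.exists_minimal_degree_vertex
  have hdeg : (G.neighborFinset w).card = δ := hw.symm.trans hmin
  obtain ⟨h1, h2⟩ := spectralRadius_le_GStarLow (w := w) hr hh hδ hδκ hnbig hcard hconn
    (by convert hdeg) hSκ hS
  exact ⟨h1, h2, fun ⟨e⟩ => spectralRadius_eq_of_iso e⟩
end

section
/- Let r ≥ 2 and h ≥ 1 be integers and let κ, δ, n be positive integers with δ ≥ κ + h and n ≥ κ + r(h+1). Let G be a connected simple graph on n vertices with minimum degree δ and h-extra r-component connectivity κ^h_r(G) = κ. Then ρ(G) ≤ ρ(K_κ ∨ (K_{n−κ−(r−1)(δ−κ+1)} ∪ (r−1)K_{δ−κ+1})), with equality if and only if G is isomorphic to K_κ ∨ (K_{n−κ−(r−1)(δ−κ+1)} ∪ (r−1)K_{δ−κ+1}). -/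
open SimpleGraph

/-- Vertex type for the extremal graph of Theorem 1.2 in the case `δ ≥ κ + h`:
the parts are `K_κ`, `K_{n-κ-(r-1)(δ-κ+1)}` and the `r-1` copies of `K_{δ-κ+1}`. -/
abbrev GVertHigh (n r κ δ : ℕ) : Type :=
  Fin κ ⊕ (Fin (n - κ - (r - 1) * (δ - κ + 1)) ⊕ (Fin (r - 1) × Fin (δ - κ + 1)))

/-- The extremal graph `K_κ ∨ (K_{n-κ-(r-1)(δ-κ+1)} ∪ (r-1)K_{δ-κ+1})`. -/
def GStarHigh (n r κ δ : ℕ) : SimpleGraph (GVertHigh n r κ δ) :=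
  SimpleGraph.fromRel fun a b =>
    match a, b with
    | .inl _, _ => True
    | .inr (.inl _), .inr (.inl _) => True
    | .inr (.inr p), .inr (.inr q) => p.1 = q.1
    | _, _ => False

namespace SimpleGraph

open Finset

section Spectral

variable {V W : Type*} [Fintype V]

lemma spectralRadius_eq_iSup_eigenvalues [DecidableEq V] (G : SimpleGraph V)
    [DecidableRel G.Adj] :
    G.spectralRadius = ⨆ i, (adjMatrix_isHermitian G).eigenvalues i := by
  unfold SimpleGraph.spectralRadius
  congr!

lemma posSemidef_spectralRadius_smul_one_sub_adjMatrix [DecidableEq V] (G : SimpleGraph V)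
    [DecidableRel G.Adj] :
    (G.spectralRadius • (1 : Matrix V V ℝ) - G.adjMatrix ℝ).PosSemidef := by
  have hA := adjMatrix_isHermitian G
  have hle : ∀ i, hA.eigenvalues i ≤ G.spectralRadius := fun i =>
    G.spectralRadius_eq_iSup_eigenvalues ▸ le_ciSup (Set.finite_range _).bddAbove i
  set φ := Unitary.conjStarAlgAut ℝ (Matrix V V ℝ) hA.eigenvectorUnitary
  have hφ : G.spectralRadius • (1 : Matrix V V ℝ) - G.adjMatrix ℝ =
      φ (Matrix.diagonal fun i => G.spectralRadius - hA.eigenvalues i) := by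
    have hd : (Matrix.diagonal fun i => G.spectralRadius - hA.eigenvalues i) =
        G.spectralRadius • (1 : Matrix V V ℝ) -
          Matrix.diagonal (RCLike.ofReal ∘ hA.eigenvalues) := by
      rw [Matrix.smul_one_eq_diagonal, Matrix.diagonal_sub]
      rfl
    rw [hd, map_sub, map_smul, map_one, ← hA.spectral_theorem]
  rw [hφ, Unitary.conjStarAlgAut_apply]
  exact (Matrix.PosSemidef.diagonal fun i => sub_nonneg.2 (hle i)).mul_mul_conjTranspose_same _

lemma exists_nonneg_eigenvector [Nonempty V] (G : SimpleGraph V) [DecidableRel G.Adj] :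
    ∃ y : V → ℝ, (∀ v, 0 ≤ y v) ∧ y ≠ 0 ∧
      ∀ v, ∑ w ∈ G.neighborFinset v, y w = G.spectralRadius * y v := by
  classical
  have hA := adjMatrix_isHermitian G
  obtain ⟨j, hj⟩ : ∃ j, hA.eigenvalues j = G.spectralRadius :=
    G.spectralRadius_eq_iSup_eigenvalues ▸ exists_eq_ciSup_of_finite
  set z : V → ℝ := (hA.eigenvectorBasis j).ofLp with hz
  have hz0 : z ≠ 0 := by
    intro h
    exact hA.eigenvectorBasis.orthonormal.ne_zero j ((WithLp.ofLp_injective 2) h)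
  have hev : ∀ v, ∑ w ∈ G.neighborFinset v, z w = G.spectralRadius * z v := by
    intro v
    have := congrFun (hA.mulVec_eigenvectorBasis j) v
    rwa [adjMatrix_mulVec_apply, hj] at this
  have hP := G.posSemidef_spectralRadius_smul_one_sub_adjMatrix
  have happ : ∀ x : V → ℝ, ∀ v,
      ((G.spectralRadius • (1 : Matrix V V ℝ) - G.adjMatrix ℝ).mulVec x) v =
        G.spectralRadius * x v - ∑ w ∈ G.neighborFinset v, x w := by
    intro x v
    rw [Matrix.sub_mulVec, Pi.sub_apply, adjMatrix_mulVec_apply, Matrix.smul_mulVec,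
      Matrix.one_mulVec]
    rfl
  have hker : (G.spectralRadius • (1 : Matrix V V ℝ) - G.adjMatrix ℝ).mulVec
      (fun v => |z v|) = 0 := by
    rw [← hP.dotProduct_mulVec_zero_iff]
    refine le_antisymm (Finset.sum_nonpos fun v _ => ?_) (hP.dotProduct_mulVec_nonneg _)
    rw [happ]
    have h1 : |G.spectralRadius * z v| ≤ ∑ w ∈ G.neighborFinset v, |z w| := by
      rw [← hev v]
      exact Finset.abs_sum_le_sum_abs _ _
    have h2 : G.spectralRadius * |z v| ≤ |G.spectralRadius * z v| := by
      rw [abs_mul]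
      exact mul_le_mul_of_nonneg_right (le_abs_self _) (abs_nonneg _)
    simpa using mul_nonpos_of_nonneg_of_nonpos (abs_nonneg (z v)) (by linarith)
  refine ⟨fun v => |z v|, fun v => abs_nonneg _, ?_, fun v => ?_⟩
  · intro h
    exact hz0 (funext fun v => abs_eq_zero.1 (congrFun h v))
  · have := congrFun hker v
    rw [happ, Pi.zero_apply] at this
    linarith

lemma Connected.exists_pos_eigenvector {G : SimpleGraph V} [DecidableRel G.Adj]
    (hG : G.Connected) :
    ∃ y : V → ℝ, (∀ v, 0 < y v) ∧
      ∀ v, ∑ w ∈ G.neighborFinset v, y w = G.spectralRadius * y v := by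
  have := hG.nonempty
  obtain ⟨y, hy, hy0, hev⟩ := G.exists_nonneg_eigenvector
  refine ⟨y, fun v => (hy v).lt_of_ne' fun hv => hy0 ?_, hev⟩
  have hstep : ∀ a b, G.Adj a b → y a = 0 → y b = 0 := by
    intro a b hab ha
    have h := hev a
    rw [ha, mul_zero, Finset.sum_eq_zero_iff_of_nonneg fun w _ => hy w] at h
    exact h b (by simpa using hab)
  funext w
  obtain ⟨p⟩ := hG.preconnected v w
  induction p with
  | nil => exact hv
  | cons hab _ ih => exact ih (hstep _ _ hab hv)

lemma sum_mul_sum_neighborFinset_comm (G : SimpleGraph V) [DecidableRel G.Adj]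
    (x y : V → ℝ) :
    ∑ v, y v * ∑ w ∈ G.neighborFinset v, x w = ∑ v, x v * ∑ w ∈ G.neighborFinset v, y w := by
  simp_rw [Finset.mul_sum, neighborFinset_eq_filter, Finset.sum_filter]
  rw [Finset.sum_comm]
  simp_rw [G.adj_comm, mul_comm]

/-- A positive vector `x` with `A x ≤ lam x` certifies `ρ(G) ≤ lam`; if `ρ(G) = lam`, it is an
eigenvector. -/
lemma Connected.spectralRadius_le_of_pos {G : SimpleGraph V} [DecidableRel G.Adj]
    (hG : G.Connected) {x : V → ℝ} {lam : ℝ} (hx : ∀ v, 0 < x v)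
    (hle : ∀ v, ∑ w ∈ G.neighborFinset v, x w ≤ lam * x v) :
    G.spectralRadius ≤ lam ∧
      (G.spectralRadius = lam → ∀ v, ∑ w ∈ G.neighborFinset v, x w = lam * x v) := by
  obtain ⟨y, hy, hev⟩ := hG.exists_pos_eigenvector
  have := hG.nonempty
  have key : ∑ v, y v * (lam * x v - ∑ w ∈ G.neighborFinset v, x w) =
      (lam - G.spectralRadius) * ∑ v, y v * x v := by
    simp_rw [mul_sub, Finset.sum_sub_distrib]
    rw [G.sum_mul_sum_neighborFinset_comm x y]
    simp_rw [hev, sub_mul, Finset.mul_sum]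
    congr 1 <;> exact Finset.sum_congr rfl fun v _ => by ring
  have hpos : 0 < ∑ v, y v * x v :=
    Finset.sum_pos (fun v _ => mul_pos (hy v) (hx v)) Finset.univ_nonempty
  have hterm : ∀ v ∈ Finset.univ, 0 ≤ y v * (lam * x v - ∑ w ∈ G.neighborFinset v, x w) :=
    fun v _ => mul_nonneg (hy v).le (sub_nonneg.2 (hle v))
  constructor
  · have h := Finset.sum_nonneg hterm
    rw [key] at h
    exact sub_nonneg.1 (nonneg_of_mul_nonneg_left h hpos)
  · intro h v
    rw [h, sub_self, zero_mul, Finset.sum_eq_zero_iff_of_nonneg hterm] at key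
    have := (mul_eq_zero.1 (key v (Finset.mem_univ v))).resolve_left (hy v).ne'
    linarith

lemma Iso.spectralRadius_le [Fintype W] {G : SimpleGraph V} {H : SimpleGraph W}
    (e : G ≃g H) (hG : G.Connected) : G.spectralRadius ≤ H.spectralRadius := by
  classical
  obtain ⟨y, hy, hev⟩ := (e.connected_iff.1 hG).exists_pos_eigenvector
  refine (hG.spectralRadius_le_of_pos (x := y ∘ e) (fun v => hy _) fun v => ?_).1
  rw [Function.comp_apply, ← hev]
  refine (Finset.sum_equiv e.toEquiv (fun w => ?_) fun w _ => rfl).le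
  rw [mem_neighborFinset, mem_neighborFinset]
  exact e.map_adj_iff.symm

lemma Iso.spectralRadius_eq [Fintype W] {G : SimpleGraph V} {H : SimpleGraph W}
    (e : G ≃g H) (hG : G.Connected) : G.spectralRadius = H.spectralRadius :=
  (e.spectralRadius_le hG).antisymm (e.symm.spectralRadius_le (e.connected_iff.1 hG))

end Spectral

section JoinCliques

variable {V W ι : Type*}

/-- The join of a clique, on the fiber of `g` over `none`, with a disjoint union of cliques, on
the fibers of `g` over the `some i`. -/
def joinCliques (g : V → Option ι) : SimpleGraph V where
  Adj v w := v ≠ w ∧ (g v = none ∨ g w = none ∨ g v = g w)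
  symm := ⟨fun _ _ h => ⟨h.1.symm, by tauto⟩⟩
  loopless := ⟨fun _ h => h.1 rfl⟩

lemma joinCliques_adj {g : V → Option ι} {v w : V} :
    (joinCliques g).Adj v w ↔ v ≠ w ∧ (g v = none ∨ g w = none ∨ g v = g w) :=
  Iff.rfl

lemma joinCliques_connected {g : V → Option ι} {s : V} (hs : g s = none) :
    (joinCliques g).Connected := by
  rw [connected_iff_exists_forall_reachable]
  refine ⟨s, fun w => ?_⟩
  by_cases h : s = w
  · exact h ▸ Reachable.rfl
  · exact Adj.reachable ⟨h, Or.inl hs⟩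

lemma joinCliques_map (σ : Equiv.Perm ι) (g : V → Option ι) :
    joinCliques (fun v => (g v).map σ) = joinCliques g := by
  ext v w
  simp only [joinCliques_adj, Option.map_eq_none_iff, (Option.map_injective σ.injective).eq_iff]

/-- Two joins of cliques with parts of the same sizes are isomorphic. -/
lemma nonempty_joinCliques_iso [Fintype V] [Fintype W] [DecidableEq ι]
    {f : V → Option ι} {g : W → Option ι}
    (h : ∀ c, #{v | f v = c} = #{w | g w = c}) : Nonempty (joinCliques f ≃g joinCliques g) := by
  let e : ∀ c, {v // f v = c} ≃ {w // g w = c} := fun c =>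
    Fintype.equivOfCardEq (by rw [Fintype.card_subtype, Fintype.card_subtype, h])
  have he : ∀ v, g (Equiv.ofFiberEquiv e v) = f v := Equiv.ofFiberEquiv_map e
  refine ⟨⟨Equiv.ofFiberEquiv e, fun {a b} => ?_⟩⟩
  rw [joinCliques_adj, joinCliques_adj, he, he, (Equiv.ofFiberEquiv e).injective.ne_iff]

variable [Fintype V]

lemma sum_neighborFinset_joinCliques_of_none {g : V → Option ι}
    [DecidableRel (joinCliques g).Adj] {v : V} (hv : g v = none) (x : V → ℝ) :
    ∑ w ∈ (joinCliques g).neighborFinset v, x w + x v = ∑ w, x w := by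
  classical
  have h : (joinCliques g).neighborFinset v = univ.erase v := by
    ext w
    simp [joinCliques_adj, hv, eq_comm]
  rw [h, Finset.sum_erase_add _ _ (mem_univ v)]

variable [DecidableEq ι]

lemma sum_neighborFinset_joinCliques_of_some {g : V → Option ι}
    [DecidableRel (joinCliques g).Adj] {v : V} {i : ι} (hv : g v = some i) (x : V → ℝ) :
    ∑ w ∈ (joinCliques g).neighborFinset v, x w + x v =
      ∑ w with g w = none, x w + ∑ w with g w = some i, x w := by
  classical
  have h : (joinCliques g).neighborFinset v =
      (({w | g w = none} : Finset V) ∪ ({w | g w = some i} : Finset V)).erase v := by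
    ext w
    simp [joinCliques_adj, hv, eq_comm]
  rw [h, Finset.sum_erase_add _ _ (by simp [hv]), Finset.sum_union]
  rw [Finset.disjoint_filter]
  rintro w - h1 h2
  simp [h1] at h2

lemma sum_eq_sum_none_add_sum_some [Fintype ι] (g : V → Option ι) {M : Type*}
    [AddCommMonoid M] (x : V → M) :
    ∑ w, x w = ∑ w with g w = none, x w + ∑ i, ∑ w with g w = some i, x w := by
  rw [← Finset.sum_fiberwise univ g x, Fintype.sum_option]

/-- The characteristic equation satisfied by the spectral radius of a join of cliques. -/
lemma joinCliques_spectralRadius_equation [Fintype ι] {g : V → Option ι}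
    (hg : Function.Surjective g) :
    (∀ i, (#{v | g v = some i} : ℝ) < (joinCliques g).spectralRadius + 1) ∧
      #{v | g v = none} + ∑ i, #{v | g v = some i} *
        (#{v | g v = none} / ((joinCliques g).spectralRadius + 1 - #{v | g v = some i})) =
          (joinCliques g).spectralRadius + 1 := by
  classical
  obtain ⟨s, hs⟩ := hg none
  obtain ⟨y, hy, hev⟩ := (joinCliques_connected hs).exists_pos_eigenvector
  set L := (joinCliques g).spectralRadius + 1 with hL
  set n : ι → ℝ := fun i => #{v | g v = some i}
  set k : ℝ := (#{v | g v = none} : ℝ)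
  set T : Option ι → ℝ := fun c => ∑ w with g w = c, y w with hT
  have hTpos : ∀ c, 0 < T c := by
    intro c
    obtain ⟨v, hv⟩ := hg c
    exact Finset.sum_pos (fun w _ => hy w) ⟨v, by simp [hv]⟩
  have hn : ∀ i, 0 < n i := by
    intro i
    obtain ⟨v, hv⟩ := hg (some i)
    exact Nat.cast_pos.2 (Finset.card_pos.2 ⟨v, by simp [hv]⟩)
  have hsome : ∀ i, L * T (some i) = n i * (T none + T (some i)) := by
    intro i
    rw [hT, Finset.mul_sum, ← nsmul_eq_mul]
    refine Finset.sum_eq_card_nsmul fun v hv => ?_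
    rw [← sum_neighborFinset_joinCliques_of_some (Finset.mem_filter.1 hv).2, hev, hL]
    ring
  have hnone : L * T none = k * (T none + ∑ i, T (some i)) := by
    rw [hT, Finset.mul_sum, ← nsmul_eq_mul]
    refine Finset.sum_eq_card_nsmul fun v hv => ?_
    rw [← sum_eq_sum_none_add_sum_some,
      ← sum_neighborFinset_joinCliques_of_none (Finset.mem_filter.1 hv).2, hev, hL]
    ring
  have hlt : ∀ i, n i < L := by
    intro i
    have h1 := hsome i
    have h2 := mul_pos (hn i) (hTpos none)
    refine lt_of_mul_lt_mul_right ?_ (hTpos (some i)).le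
    linarith
  refine ⟨hlt, ?_⟩
  have hTi : ∀ i, k * T (some i) = T none * (n i * (k / (L - n i))) := by
    intro i
    have h1 := hsome i
    have h2 : L - n i ≠ 0 := (sub_pos.2 (hlt i)).ne'
    field_simp
    linear_combination k * h1
  refine mul_left_cancel₀ (hTpos none).ne' ?_
  rw [mul_add, Finset.mul_sum]
  rw [← Finset.sum_congr rfl fun i _ => hTi i, ← Finset.mul_sum]
  linarith

/-- A spanning subgraph of a join of cliques has spectral radius at most `L - 1` once `L` is a
supersolution of the characteristic equation; equality only holds for a solution, and for the
join itself. -/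
lemma Connected.spectralRadius_le_of_le_joinCliques [Fintype ι] {G : SimpleGraph V}
    (hG : G.Connected) {g : V → Option ι} (hGg : G ≤ joinCliques g) {s : V} (hs : g s = none)
    {L : ℝ} (hlt : ∀ i, (#{v | g v = some i} : ℝ) < L)
    (hle : #{v | g v = none} + ∑ i, #{v | g v = some i} *
      (#{v | g v = none} / (L - #{v | g v = some i})) ≤ L) :
    G.spectralRadius ≤ L - 1 ∧ (G.spectralRadius = L - 1 →
      G = joinCliques g ∧ #{v | g v = none} + ∑ i, #{v | g v = some i} *
        (#{v | g v = none} / (L - #{v | g v = some i})) = L) := by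
  classical
  set n : ι → ℝ := fun i => #{v | g v = some i}
  set k : ℝ := (#{v | g v = none} : ℝ) with hk
  have hkpos : 0 < k := Nat.cast_pos.2 (Finset.card_pos.2 ⟨s, by simp [hs]⟩)
  let X : Option ι → ℝ := fun c => c.elim 1 fun i => k / (L - n i)
  have hX : ∀ c, 0 < X c := by
    rintro (_ | i)
    · exact one_pos
    · exact div_pos hkpos (sub_pos.2 (hlt i))
  have hfib : ∀ c, ∑ w with g w = c, X (g w) = #{w | g w = c} * X c := by
    intro c
    rw [← nsmul_eq_mul]
    exact Finset.sum_eq_card_nsmul fun w hw => by rw [(Finset.mem_filter.1 hw).2]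
  have hsub : ∀ v, G.neighborFinset v ⊆ (joinCliques g).neighborFinset v := by
    intro v w hw
    rw [mem_neighborFinset] at hw ⊢
    exact hGg hw
  have hmono : ∀ v, ∑ w ∈ G.neighborFinset v, X (g w) ≤
      ∑ w ∈ (joinCliques g).neighborFinset v, X (g w) := fun v =>
    Finset.sum_le_sum_of_subset_of_nonneg (hsub v) fun w _ _ => (hX _).le
  have hnone : ∀ v, g v = none → ∑ w ∈ (joinCliques g).neighborFinset v, X (g w) =
      k + ∑ i, n i * (k / (L - n i)) - 1 := by
    intro v hv
    have h := sum_neighborFinset_joinCliques_of_none hv fun w => X (g w)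
    rw [sum_eq_sum_none_add_sum_some g] at h
    simp_rw [hfib, hv] at h
    change _ + (1 : ℝ) = k * 1 + ∑ i, n i * (k / (L - n i)) at h
    linarith
  have hsome : ∀ v i, g v = some i → ∑ w ∈ (joinCliques g).neighborFinset v, X (g w) =
      (L - 1) * X (g v) := by
    intro v i hv
    have h := sum_neighborFinset_joinCliques_of_some hv fun w => X (g w)
    simp_rw [hfib, hv] at h
    rw [hv]
    change _ + k / (L - n i) = k * 1 + n i * (k / (L - n i)) at h
    change _ = (L - 1) * (k / (L - n i))
    have h2 : L - n i ≠ 0 := (sub_pos.2 (hlt i)).ne'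
    rw [eq_sub_of_add_eq h]
    field_simp
    ring
  have hsuper : ∀ v, ∑ w ∈ (joinCliques g).neighborFinset v, X (g w) ≤ (L - 1) * X (g v) := by
    intro v
    rcases hv : g v with _ | i
    · rw [hnone v hv]
      change _ ≤ (L - 1) * 1
      linarith
    · rw [hsome v i hv, hv]
  obtain ⟨h1, h2⟩ := hG.spectralRadius_le_of_pos (x := fun v => X (g v)) (fun v => hX _)
    fun v => (hmono v).trans (hsuper v)
  refine ⟨h1, fun hρ => ?_⟩
  have heq := h2 hρ
  constructor
  · refine le_antisymm hGg fun v w hvw => ?_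
    by_contra hGvw
    have : ∑ w ∈ G.neighborFinset v, X (g w) < ∑ w ∈ (joinCliques g).neighborFinset v, X (g w) :=
      Finset.sum_lt_sum_of_subset (hsub v) (i := w) (by simpa using hvw) (by simpa using hGvw)
        (hX _) fun w _ _ => (hX _).le
    linarith [heq v, hsuper v]
  · have h3 := heq s ▸ hmono s
    rw [hnone s hs, hs] at h3
    change (L - 1) * 1 ≤ _ at h3
    linarith

end JoinCliques

section Convexity

variable {ι : Type*} [Fintype ι]

lemma div_sub_le_chord {L M m x : ℝ} (hL : 0 < L) (hM : M < L) (hm : m ≤ x) (hx : x ≤ M) :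
    x / (L - x) ≤ m / (L - m) + (x - m) * (L / ((L - M) * (L - m))) ∧
      (x / (L - x) = m / (L - m) + (x - m) * (L / ((L - M) * (L - m))) → x = m ∨ x = M) := by
  have h1 : 0 < L - M := by linarith
  have h2 : 0 < L - x := by linarith
  have h3 : 0 < L - m := by linarith
  have key : m / (L - m) + (x - m) * (L / ((L - M) * (L - m))) - x / (L - x) =
      L * (x - m) * (M - x) / ((L - M) * (L - x) * (L - m)) := by
    field_simp
    ring
  constructor
  · rw [← sub_nonneg, key]
    have := sub_nonneg.2 hm
    have := sub_nonneg.2 hx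
    positivity
  · intro h
    rw [h, sub_self, eq_comm, div_eq_zero_iff] at key
    rcases key with h4 | h4
    · rcases mul_eq_zero.1 h4 with h5 | h5
      · left
        linarith [(mul_eq_zero.1 h5).resolve_left hL.ne']
      · right
        linarith
    · exact absurd h4 (by positivity)

/-- Among families bounded below by `m` with a given sum, the sum of the values of the strictly
convex function `x / (L - x)` is the largest exactly when all but one of the terms equal `m`. -/
lemma sum_div_sub_le {L M m : ℝ} (hL : 0 < L) (hM : M < L) {n : ι → ℝ} (hm : ∀ i, m ≤ n i)
    (hmM : m ≤ M) (hsum : ∑ i, (n i - m) = M - m) [Nonempty ι] :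
    (∀ i, n i ≤ M) ∧
    ∑ i, (n i / (L - n i) - m / (L - m)) ≤ M / (L - M) - m / (L - m) ∧
      (∑ i, (n i / (L - n i) - m / (L - m)) = M / (L - M) - m / (L - m) →
        ∃ i, n i = M ∧ ∀ j ≠ i, n j = m) := by
  classical
  have hnn : ∀ i ∈ univ, 0 ≤ n i - m := fun i _ => sub_nonneg.2 (hm i)
  have hnM : ∀ i, n i ≤ M := by
    intro i
    have := Finset.single_le_sum hnn (mem_univ i)
    linarith
  set K := L / ((L - M) * (L - m))
  have hK : M / (L - M) - m / (L - m) = ∑ i, (n i - m) * K := by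
    have h1 : L - M ≠ 0 := by linarith
    have h2 : L - m ≠ 0 := by linarith
    rw [← Finset.sum_mul, hsum]
    simp only [K]
    field_simp
    ring
  have hterm : ∀ i ∈ univ, n i / (L - n i) - m / (L - m) ≤ (n i - m) * K := fun i _ => by
    have := (div_sub_le_chord hL hM (hm i) (hnM i)).1
    linarith
  refine ⟨hnM, hK ▸ Finset.sum_le_sum hterm, fun h => ?_⟩
  rw [hK, Finset.sum_eq_sum_iff_of_le hterm] at h
  have hcases : ∀ i, n i = m ∨ n i = M := fun i =>
    (div_sub_le_chord hL hM (hm i) (hnM i)).2 (by linarith [h i (mem_univ i)])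
  obtain ⟨i, hi⟩ : ∃ i, n i = M := by
    by_contra! hne
    have hall : ∀ i, n i = m := fun i => (hcases i).resolve_right (hne i)
    simp only [hall, sub_self, Finset.sum_const_zero] at hsum
    exact hne (Classical.arbitrary ι) (by rw [hall]; linarith)
  refine ⟨i, hi, fun j hj => ?_⟩
  rw [← Finset.add_sum_erase _ _ (mem_univ i), hi] at hsum
  have h0 : ∑ j ∈ univ.erase i, (n j - m) = 0 := by linarith
  rw [Finset.sum_eq_zero_iff_of_nonneg fun j _ => sub_nonneg.2 (hm j)] at h0
  linarith [h0 j (by simpa using hj)]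

end Convexity

end SimpleGraph

open Finset

section ExtraConnectivity

variable {V : Type*} [Fintype V]

/-- Grouping the components left by a good vertex cut presents the graph as a spanning subgraph
of a join of cliques. -/
lemma GoodVertexCut.exists_le_joinCliques {G : SimpleGraph V} {r h : ℕ} {S : Finset V}
    (hS : GoodVertexCut G r h S) {ι : Type*} [Fintype ι] [Nonempty ι]
    (hι : Fintype.card ι ≤ r) :
    ∃ g : V → Option ι, (∀ v, g v = none ↔ v ∈ S) ∧ (∀ i, ∃ v, g v = some i) ∧
      G ≤ joinCliques g := by
  classical
  let C := (G.induce ((S : Set V)ᶜ)).ConnectedComponent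
  have := Fintype.ofFinite C
  have hcard : Fintype.card ι ≤ Fintype.card C := by
    rw [← Nat.card_eq_fintype_card (α := C)]
    exact hι.trans hS.1
  obtain ⟨f⟩ := Function.Embedding.nonempty_of_card_le hcard
  let φ : C → ι := Function.invFun f
  have hφ : Function.Surjective φ := Function.invFun_surjective f.injective
  let g : V → Option ι := fun v =>
    if hv : v ∈ S then none else some (φ ((G.induce ((S : Set V)ᶜ)).connectedComponentMk ⟨v, hv⟩))
  refine ⟨g, fun v => ?_, fun i => ?_, fun v w hvw => ⟨hvw.ne, ?_⟩⟩
  · by_cases hv : v ∈ S <;> simp [g, hv]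
  · obtain ⟨c, hc⟩ := hφ i
    induction c using ConnectedComponent.ind with
    | h v => exact ⟨v, by rw [← hc]; exact dif_neg v.2⟩
  · by_cases hv : v ∈ S
    · exact Or.inl (dif_pos hv)
    by_cases hw : w ∈ S
    · exact Or.inr (Or.inl (dif_pos hw))
    refine Or.inr (Or.inr ?_)
    simp only [g, dif_neg hv, dif_neg hw]
    congr 2
    exact ConnectedComponent.sound (Adj.reachable hvw)

lemma minDegree_lt_card_none_add_card_some {G : SimpleGraph V} [DecidableRel G.Adj]
    {ι : Type*} [DecidableEq ι] {g : V → Option ι} (hG : G ≤ joinCliques g) {i : ι}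
    (hi : ∃ v, g v = some i) :
    G.minDegree < #{v | g v = none} + #{v | g v = some i} := by
  classical
  obtain ⟨v, hv⟩ := hi
  calc G.minDegree ≤ G.degree v := G.minDegree_le_degree v
    _ < #(({w | g w = none} : Finset V) ∪ ({w | g w = some i} : Finset V)) := by
      refine Finset.card_lt_card ((Finset.ssubset_iff_of_subset fun w hw => ?_).2
        ⟨v, by simp [hv], by simp⟩)
      have := (hG ((G.mem_neighborFinset v w).1 hw)).2
      simpa [hv, eq_comm] using this
    _ ≤ _ := Finset.card_union_le _ _

end ExtraConnectivity

section ExtremalGraph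

variable (n r κ δ : ℕ)

/-- The labelling presenting `GStarHigh` as a join of cliques. -/
def gStarHighLabel : GVertHigh n r κ δ → Option (Option (Fin (r - 1)))
  | .inl _ => none
  | .inr (.inl _) => some none
  | .inr (.inr p) => some (some p.1)

lemma gStarHigh_eq_joinCliques : GStarHigh n r κ δ = joinCliques (gStarHighLabel n r κ δ) := by
  ext v w
  rcases v with v | v | v <;> rcases w with w | w | w <;>
    simp [GStarHigh, joinCliques_adj, gStarHighLabel, eq_comm]

lemma card_gStarHighLabel_none : #{v | gStarHighLabel n r κ δ v = none} = κ := by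
  simp only [Finset.card_filter, Fintype.sum_sum_type]
  simp [gStarHighLabel]

lemma card_gStarHighLabel_some_none :
    #{v | gStarHighLabel n r κ δ v = some none} = n - κ - (r - 1) * (δ - κ + 1) := by
  simp only [Finset.card_filter, Fintype.sum_sum_type]
  simp [gStarHighLabel]

lemma card_gStarHighLabel_some_some (j : Fin (r - 1)) :
    #{v | gStarHighLabel n r κ δ v = some (some j)} = δ - κ + 1 := by
  simp only [Finset.card_filter, Fintype.sum_sum_type, Fintype.sum_prod_type]
  simp [gStarHighLabel]

end ExtremalGraph

theorem spectral_extremal_extraConnectivity_high {V : Type*} [Fintype V] [DecidableEq V]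
    (G : SimpleGraph V) [DecidableRel G.Adj] (n r h κ δ : ℕ)
    (hr : 2 ≤ r) (hh : 1 ≤ h) (hκ : 1 ≤ κ) (hδ : 1 ≤ δ) (hn : 1 ≤ n)
    (hδκh : κ + h ≤ δ) (hnbig : κ + r * (h + 1) ≤ n)
    (hcard : Fintype.card V = n) (hconn : G.Connected)
    (hmin : G.minDegree = δ) (hκG : HasExtraConnectivity G r h κ) :
    G.spectralRadius ≤ (GStarHigh n r κ δ).spectralRadius ∧
      (G.spectralRadius = (GStarHigh n r κ δ).spectralRadius ↔
        Nonempty (G ≃g GStarHigh n r κ δ)) := by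
  classical
  obtain ⟨⟨S, hSκ, hS⟩, -⟩ := hκG
  obtain ⟨g, hgS, hgsurj, hGg⟩ := hS.exists_le_joinCliques (ι := Option (Fin (r - 1)))
    (by simp; omega)
  have hk : #{v | g v = none} = κ := by
    rw [← hSκ]
    congr 1
    ext v
    simp [hgS]
  set m := δ - κ + 1 with hm
  set N := n - κ - (r - 1) * m with hN
  have hmle : ∀ i, m ≤ #{v | g v = some i} := by
    intro i
    have := minDegree_lt_card_none_add_card_some hGg (hgsurj i)
    omega
  have htot : κ + ∑ i, #{v | g v = some i} = n := by
    have h := sum_eq_sum_none_add_sum_some g fun _ => 1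
    simp only [Finset.sum_const, smul_eq_mul, mul_one, Finset.card_univ, hk, hcard] at h
    exact h.symm
  have hrm : (r - 1) * m + m ≤ ∑ i, #{v | g v = some i} := by
    calc (r - 1) * m + m = ∑ _i : Option (Fin (r - 1)), m := by simp; ring
      _ ≤ _ := Finset.sum_le_sum fun i _ => hmle i
  have hmN : m ≤ N := by omega
  obtain ⟨s, hs⟩ : ∃ s, g s = none := by
    obtain ⟨s, hs⟩ := Finset.card_pos.1 (hSκ ▸ hκ : 0 < #S)
    exact ⟨s, (hgS s).2 hs⟩
  set H := GStarHigh n r κ δ with hH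
  have hlabel : Function.Surjective (gStarHighLabel n r κ δ)
    | none => ⟨.inl ⟨0, hκ⟩, rfl⟩
    | some none => ⟨.inr (.inl ⟨0, (by omega : 0 < N)⟩), rfl⟩
    | some (some j) => ⟨.inr (.inr (j, 0)), rfl⟩
  obtain ⟨hltH, heqH⟩ := joinCliques_spectralRadius_equation hlabel
  rw [← gStarHigh_eq_joinCliques, ← hH, card_gStarHighLabel_none, Fintype.sum_option,
    card_gStarHighLabel_some_none] at heqH
  simp only [card_gStarHighLabel_some_some, Finset.sum_const, Finset.card_univ,
    Fintype.card_fin, nsmul_eq_mul] at heqH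
  have hNL := hltH none
  rw [← gStarHigh_eq_joinCliques, ← hH, card_gStarHighLabel_some_none] at hNL
  set L := H.spectralRadius + 1 with hL
  rw [← hm, ← hN] at heqH hNL
  have hL0 : 0 < L := hNL.trans_le' (Nat.cast_nonneg N)
  have hsumR : ∑ i, ((#{v | g v = some i} : ℝ) - m) = N - m := by
    have h1 : ∑ i, #{v | g v = some i} = N + (r - 1) * m := by omega
    have h2 : ∑ i, (#{v | g v = some i} : ℝ) = N + (r - 1 : ℕ) * m := by exact_mod_cast h1
    rw [Finset.sum_sub_distrib, h2]
    simp
    ring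
  obtain ⟨hleN, hle, hext⟩ := sum_div_sub_le hL0 hNL
    (fun i => Nat.cast_le.2 (hmle i)) (Nat.cast_le.2 hmN) hsumR
  have hκR : (0 : ℝ) < κ := Nat.cast_pos.2 hκ
  have hsum : ∑ i, (#{v | g v = some i} : ℝ) * (κ / (L - #{v | g v = some i})) =
      κ * (∑ i, ((#{v | g v = some i} : ℝ) / (L - #{v | g v = some i}) - m / (L - m)) +
        r * (m / (L - m))) := by
    rw [Finset.sum_sub_distrib]
    have hr1 : ((r - 1 : ℕ) : ℝ) + 1 = r := by norm_cast; omega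
    simp only [Finset.sum_const, Finset.card_univ, Fintype.card_option, Fintype.card_fin,
      nsmul_eq_mul, Nat.cast_add, Nat.cast_one, hr1, sub_add_cancel, Finset.mul_sum]
    exact Finset.sum_congr rfl fun i _ => by ring
  have hstar : (κ : ℝ) + κ * (N / (L - N) - m / (L - m) + r * (m / (L - m))) = L := by
    have hr1 : ((r - 1 : ℕ) : ℝ) = r - 1 := by
      rw [Nat.cast_sub (by omega), Nat.cast_one]
    rw [hr1] at heqH
    linear_combination heqH
  have hcomp := hconn.spectralRadius_le_of_le_joinCliques hGg hs (L := L)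
    (fun i => (hleN i).trans_lt hNL) (by
      rw [hk, hsum]
      nlinarith)
  rw [hk, hsum, hL, add_sub_cancel_right, ← hL] at hcomp
  refine ⟨hcomp.1, fun hρ => ?_, fun ⟨e⟩ => e.spectralRadius_eq hconn⟩
  obtain ⟨hGeq, hsol⟩ := hcomp.2 hρ
  obtain ⟨i, hi, hother⟩ := hext (by
    have := mul_left_cancel₀ hκR.ne' (add_left_cancel (hsol.trans hstar.symm))
    linarith)
  rw [hGeq, ← joinCliques_map (Equiv.swap i none) g, hH, gStarHigh_eq_joinCliques]
  refine nonempty_joinCliques_iso fun c => ?_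
  rcases c with _ | j
  · simp only [Option.map_eq_none_iff, hk, card_gStarHighLabel_none]
  have hswap : ∀ v, (g v).map (Equiv.swap i none) = some j ↔
      g v = some (Equiv.swap i none j) := by
    intro v
    simp only [Option.map_eq_some_iff, Equiv.swap_apply_eq_iff, exists_eq_right]
  simp only [hswap]
  rcases j with _ | j
  · rw [Equiv.swap_apply_right, card_gStarHighLabel_some_none]
    exact_mod_cast hi
  · rw [card_gStarHighLabel_some_some]
    have hne : Equiv.swap i none (some j) ≠ i := by
      rw [ne_eq, Equiv.swap_apply_eq_iff, Equiv.swap_apply_left]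
      simp
    exact_mod_cast hother _ hne
end

section
/- Let G be a connected simple graph with Perron vector x, let u and v be two vertices of G, and suppose {v_1, v_2, …, v_s} ⊆ N_G(v) \ N_G(u) with 1 ≤ s ≤ deg_G(v). Let G* be the graph obtained from G by adding the edges u v_i and deleting the edges v v_i for 1 ≤ i ≤ s. If x_u ≥ x_v, then ρ(G) < ρ(G*). -/
open SimpleGraph

/-- The quadratic form of a graph is bounded by its spectral radius. -/
theorem SimpleGraph.posSemidef_spectralRadius_smul_one_sub_adjMatrix_s4 {V : Type*} [Fintype V]
    [DecidableEq V] (G : SimpleGraph V) [DecidableRel G.Adj] :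
    (G.spectralRadius • (1 : Matrix V V ℝ) - G.adjMatrix ℝ).PosSemidef := by
  have hle : ∀ i, (adjMatrix_isHermitian G).eigenvalues i ≤ G.spectralRadius := by
    intro i
    have hG : G.spectralRadius = ⨆ i, (adjMatrix_isHermitian G).eigenvalues i := by
      unfold SimpleGraph.spectralRadius
      congr!
    rw [hG]
    exact le_ciSup (Set.finite_range (adjMatrix_isHermitian G).eigenvalues).bddAbove i
  rw [Matrix.posSemidef_iff_isHermitian_and_spectrum_nonneg]
  refine ⟨?_, fun μ hμ => ?_⟩
  · exact (Matrix.isHermitian_one.smul (IsSelfAdjoint.all _)).sub (adjMatrix_isHermitian G)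
  · rw [← Algebra.algebraMap_eq_smul_one, ← spectrum.singleton_sub_eq,
      (adjMatrix_isHermitian G).spectrum_real_eq_range_eigenvalues] at hμ
    obtain ⟨_, rfl, _, ⟨i, rfl⟩, rfl⟩ := hμ
    exact sub_nonneg.2 (hle i)

/-- Moving the edges from `v` to `B` over to `u` is a symmetric rank-two update of the adjacency
matrix. -/
theorem SimpleGraph.adjMatrix_rotate_edges {V : Type*} [DecidableEq V]
    (G : SimpleGraph V) [DecidableRel G.Adj] (u v : V) (B : Finset V)
    (hBsub : ∀ w ∈ B, G.Adj v w ∧ ¬ G.Adj u w) (huB : u ∉ B)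
    [DecidableRel (G.deleteEdges ((fun w => s(v, w)) '' (B : Set V)) ⊔
      SimpleGraph.fromEdgeSet ((fun w => s(u, w)) '' (B : Set V))).Adj] :
    (G.deleteEdges ((fun w => s(v, w)) '' (B : Set V)) ⊔
      SimpleGraph.fromEdgeSet ((fun w => s(u, w)) '' (B : Set V))).adjMatrix ℝ =
    G.adjMatrix ℝ +
      Matrix.vecMulVec (Pi.single u 1 - Pi.single v 1) (fun w => if w ∈ B then 1 else 0) +
      Matrix.vecMulVec (fun w => if w ∈ B then 1 else 0) (Pi.single u 1 - Pi.single v 1) := by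
  have hvB : v ∉ B := fun h => G.loopless.irrefl v (hBsub v h).1
  have hdel : ∀ a b c, s(a, b) ∈ (fun w => s(c, w)) '' (B : Set V) ↔
      (a = c ∧ b ∈ B) ∨ (b = c ∧ a ∈ B) := by
    intro a b c
    simp only [Set.mem_image, Finset.mem_coe, Sym2.eq_iff]
    grind
  ext a b
  simp only [adjMatrix_apply, sup_adj, deleteEdges_adj, fromEdgeSet_adj, hdel, Matrix.add_apply,
    Matrix.vecMulVec_apply, Pi.sub_apply, Pi.single_apply]
  have hsymm := G.adj_comm a b
  have h1 := hBsub a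
  have h2 := hBsub b
  by_cases ha : a ∈ B <;> by_cases hb : b ∈ B <;> by_cases hau : a = u <;> by_cases hav : a = v <;>
    by_cases hbu : b = u <;> by_cases hbv : b = v <;> by_cases hab : G.Adj a b <;>
    (simp_all; try grind)

theorem spectralRadius_lt_of_rotate_edges {V : Type*} [Fintype V] [DecidableEq V]
    (G : SimpleGraph V) [DecidableRel G.Adj] (hconn : G.Connected)
    (x : V → ℝ) (hx : G.IsPerronVector x) (u v : V) (B : Finset V) (hB : B.Nonempty)
    (hBsub : ∀ w ∈ B, G.Adj v w ∧ ¬ G.Adj u w) (huB : u ∉ B) (hxu : x v ≤ x u) :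
    G.spectralRadius <
      (G.deleteEdges ((fun w => s(v, w)) '' (B : Set V)) ⊔
        SimpleGraph.fromEdgeSet ((fun w => s(u, w)) '' (B : Set V))).spectralRadius := by
  classical
  obtain ⟨hpos, hnorm, heig⟩ := hx
  have hvB : v ∉ B := fun h => G.loopless.irrefl v (hBsub v h).1
  have huv : v ≠ u := by
    rintro rfl
    obtain ⟨w, hw⟩ := hB
    exact (hBsub w hw).2 (hBsub w hw).1
  have hadj := G.adjMatrix_rotate_edges u v B hBsub huB
  set H := G.deleteEdges ((fun w => s(v, w)) '' (B : Set V)) ⊔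
    SimpleGraph.fromEdgeSet ((fun w => s(u, w)) '' (B : Set V))
  have hpsd := H.posSemidef_spectralRadius_smul_one_sub_adjMatrix_s4
  set S := ∑ w ∈ B, x w with hS
  have hSpos : 0 < S := Finset.sum_pos (fun w _ => hpos w) hB
  have hSdot : (fun w => if w ∈ B then (1 : ℝ) else 0) ⬝ᵥ x = S := by
    simp [dotProduct, hS]
  have hmul : (H.adjMatrix ℝ).mulVec x = G.spectralRadius • x + S • (Pi.single u 1 - Pi.single v 1) +
      (x u - x v) • fun w => if w ∈ B then (1 : ℝ) else 0 := by
    rw [hadj, Matrix.add_mulVec, Matrix.add_mulVec, heig, Matrix.vecMulVec_mulVec,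
      Matrix.vecMulVec_mulVec, hSdot, sub_dotProduct, single_one_dotProduct,
      single_one_dotProduct]
    simp only [op_smul_eq_smul]
  have hxx : x ⬝ᵥ x = 1 := by simpa [dotProduct, sq] using hnorm
  have hquad : x ⬝ᵥ (H.spectralRadius • (1 : Matrix V V ℝ) - H.adjMatrix ℝ).mulVec x =
      H.spectralRadius - G.spectralRadius - 2 * (S * (x u - x v)) := by
    rw [Matrix.sub_mulVec, hmul, Matrix.smul_mulVec, Matrix.one_mulVec]
    simp only [dotProduct_sub, dotProduct_add, dotProduct_smul, hxx, dotProduct_comm x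
      (fun w => if w ∈ B then (1 : ℝ) else 0), hSdot, dotProduct_single_one, smul_eq_mul]
    ring
  have hprod : 0 ≤ S * (x u - x v) := mul_nonneg hSpos.le (sub_nonneg.2 hxu)
  by_contra! hlt
  have hnonneg : 0 ≤ x ⬝ᵥ (H.spectralRadius • (1 : Matrix V V ℝ) - H.adjMatrix ℝ).mulVec x := by
    simpa using hpsd.dotProduct_mulVec_nonneg x
  have hρ : H.spectralRadius = G.spectralRadius := by linarith
  have hker := (hpsd.dotProduct_mulVec_zero_iff x).1 (by
    rw [star_trivial]; linarith)
  have hv := congrFun hker v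
  rw [Matrix.sub_mulVec, hmul, Matrix.smul_mulVec, Matrix.one_mulVec, hρ] at hv
  simp [hvB, huv] at hv
  linarith
end
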